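/- Let N = p1^m · p2^n where m, n ≥ 1 and p1, p2 are primes with {p1 mod 4, p2 mod 4} = {1, 3}. Let p be a prime with gcd(p, N) = 1 such that ord_{p1^m}(p) = φ(p1^m), ord_{p2^n}(p) = φ(p2^n), and f := ord_N(p) = φ(N)/2; let q = p^f. Let χ be a multiplicative character of order N of F_q, let h be the class number of the imaginary quadratic field Q(√(−p1·p2)), and set h0 = (f − h)/2. Then h is even andthere exist integers b, c such that: (1) b ≢ 0 (mod p) and c ≢ 0 (mod p); (2) b² + p1·p2·c² = 4·p^h; (3) b ≡ 2·p^{h/2} (mod ℓ), where ℓ ∈ {p1, p2} is the one congruent to 3 modulo 4; and (4) the Gauss sum satisfies g(χ) = ((b + c·i·√(p1·p2))/2)·p^{h0} or g(χ) = ((b − c·i·√(p1·p2))/2)·p^{h0} in the complex numbers (i.e., g(χ) is determined up to complex conjugation by this formula). -/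

import Mathlib

section

open NumberField

namespace IdealCount

variable {S : Type*} [CommRing S] [IsDedekindDomain S] [Module.Free ℤ S]

theorem absNorm_sup_span_dvd [Module.Finite ℤ S] (I : Ideal S) (a : ℕ) :
    Ideal.absNorm (I ⊔ Ideal.span {(a : S)}) ∣ a ^ Module.finrank ℤ S := by
  have := Ideal.absNorm_dvd_absNorm_of_le (le_sup_right : Ideal.span {(a : S)} ≤ I ⊔ Ideal.span {(a : S)})
  rwa [Ideal.absNorm_span_singleton, ← Int.cast_natCast (R := S), ← eq_intCast (algebraMap ℤ S),
    Algebra.norm_algebraMap, Int.natAbs_pow, Int.natAbs_natCast, eq_intCast,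
    Int.cast_natCast] at this

theorem natCast_mem_of_absNorm_eq {I : Ideal S} {a : ℕ} (h : Ideal.absNorm I = a) : (a : S) ∈ I :=
  h ▸ Ideal.absNorm_mem I

theorem mul_sup_span {J L : Ideal S} {a b : ℕ} (hab : a.Coprime b)
    (hJ : Ideal.absNorm J = a) (hL : Ideal.absNorm L = b) :
    J * L ⊔ Ideal.span {(a : S)} = J := by
  have ha := natCast_mem_of_absNorm_eq hJ
  have hb := natCast_mem_of_absNorm_eq hL
  have h1 : L ⊔ Ideal.span {(a : S)} = ⊤ := by
    have := (Nat.isCoprime_iff_coprime.mpr hab).map (Int.castRingHom S)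
    have h2 : Ideal.span {(a : S)} ⊔ Ideal.span {(b : S)} = ⊤ := by
      rw [← Ideal.span_union, Set.singleton_union, Ideal.eq_top_iff_one, Ideal.mem_span_pair]
      simpa [IsCoprime] using this
    rw [eq_top_iff, ← h2]
    exact sup_le le_sup_right (((Ideal.span_singleton_le_iff_mem _).2 hb).trans le_sup_left)
  apply le_antisymm
  · exact sup_le Ideal.mul_le_left ((Ideal.span_singleton_le_iff_mem _).2 ha)
  · calc J = J * (L ⊔ Ideal.span {(a : S)}) := by rw [h1, Ideal.mul_top]
      _ ≤ _ := by
        rw [Ideal.mul_sup]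
        exact sup_le_sup le_rfl Ideal.mul_le_right

/-- an ideal of norm `p ^ k` divides `(p) ^ k`. -/
theorem dvd_span_pow {I : Ideal S} {p k : ℕ} (h : Ideal.absNorm I = p ^ k) :
    I ∣ Ideal.span {(p : S)} ^ k := by
  rw [Ideal.span_singleton_pow, Ideal.dvd_span_singleton]
  exact_mod_cast natCast_mem_of_absNorm_eq h

theorem sup_span_mul_sup_span {I : Ideal S} {a b : ℕ} (hab : a.Coprime b)
    (hI : Ideal.absNorm I = a * b) :
    (I ⊔ Ideal.span {(a : S)}) * (I ⊔ Ideal.span {(b : S)}) = I := by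
  have h1 : Ideal.span {(a : S)} ⊔ Ideal.span {(b : S)} = ⊤ := by
    have := (Nat.isCoprime_iff_coprime.mpr hab).map (Int.castRingHom S)
    rw [← Ideal.span_union, Set.singleton_union, Ideal.eq_top_iff_one, Ideal.mem_span_pair]
    simpa [IsCoprime] using this
  have h2 : Ideal.span {(a : S)} * Ideal.span {(b : S)} ≤ I := by
    rw [Ideal.span_singleton_mul_span_singleton, Ideal.span_singleton_le_iff_mem]
    exact_mod_cast natCast_mem_of_absNorm_eq hI
  apply le_antisymm
  · rw [Ideal.sup_mul, Ideal.mul_sup, Ideal.mul_sup]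
    exact sup_le (sup_le Ideal.mul_le_left Ideal.mul_le_left) (sup_le Ideal.mul_le_right h2)
  · calc I = I * (Ideal.span {(a : S)} ⊔ Ideal.span {(b : S)}) := by rw [h1, Ideal.mul_top]
      _ ≤ _ := by
        rw [Ideal.mul_sup]
        refine sup_le ?_ ?_
        · rw [mul_comm]; exact Ideal.mul_mono le_sup_right le_sup_left
        · exact Ideal.mul_mono le_sup_left le_sup_right

theorem card_absNorm_mul [Module.Finite ℤ S] {a b : ℕ} (hab : a.Coprime b) :
    Nat.card {I : Ideal S // Ideal.absNorm I = a * b} =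
      Nat.card {I : Ideal S // Ideal.absNorm I = a} *
        Nat.card {I : Ideal S // Ideal.absNorm I = b} := by
  rw [← Nat.card_prod]
  symm
  refine Nat.card_congr (Equiv.ofBijective
    (fun x => ⟨x.1.1 * x.2.1, by rw [map_mul, x.1.2, x.2.2]⟩) ⟨?_, ?_⟩)
  · rintro ⟨⟨J, hJ⟩, ⟨L, hL⟩⟩ ⟨⟨J', hJ'⟩, ⟨L', hL'⟩⟩ h
    have h : J * L = J' * L' := congrArg Subtype.val h
    have e1 : J = J' := by
      rw [← mul_sup_span hab hJ hL, h, mul_sup_span hab hJ' hL']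
    have e2 : L = L' := by
      rw [← mul_sup_span hab.symm hL hJ, mul_comm, h, mul_comm, mul_sup_span hab.symm hL' hJ']
    subst e1 e2; rfl
  · rintro ⟨I, hI⟩
    have hm := sup_span_mul_sup_span hab hI
    have h1 := absNorm_sup_span_dvd I a
    have h2 := absNorm_sup_span_dvd I b
    have h3 : Ideal.absNorm (I ⊔ Ideal.span {(a : S)}) * Ideal.absNorm (I ⊔ Ideal.span {(b : S)})
      = a * b := by rw [← map_mul, hm, hI]
    have c1 : (Ideal.absNorm (I ⊔ Ideal.span {(a : S)})).Coprime b :=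
      Nat.Coprime.of_dvd_left h1 (hab.pow_left _)
    have c2 : (Ideal.absNorm (I ⊔ Ideal.span {(b : S)})).Coprime a :=
      Nat.Coprime.of_dvd_left h2 (hab.symm.pow_left _)
    have d1 := c1.dvd_of_dvd_mul_right (h3 ▸ Dvd.intro _ rfl)
    have d1' := c2.symm.dvd_of_dvd_mul_right (h3.symm ▸ Dvd.intro _ rfl)
    have e1 := Nat.dvd_antisymm d1 d1'
    have d2 := c2.dvd_of_dvd_mul_left (h3 ▸ Dvd.intro_left _ rfl)
    have d2' := c1.symm.dvd_of_dvd_mul_left (h3.symm ▸ Dvd.intro_left _ rfl)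
    have e2 := Nat.dvd_antisymm d2 d2'
    exact ⟨⟨⟨_, e1⟩, ⟨_, e2⟩⟩, Subtype.ext hm⟩

theorem card_absNorm_pow_of_ramified {p : ℕ} (hp : p.Prime) {P : Ideal S}
    (hP : Ideal.absNorm P = p) (h : Ideal.span {(p : S)} = P ^ 2) (k : ℕ) :
    Nat.card {I : Ideal S // Ideal.absNorm I = p ^ k} = 1 := by
  have hPp : Prime P := by
    refine Ideal.prime_of_isPrime ?_ (Ideal.isPrime_of_irreducible_absNorm (hP ▸ hp))
    rintro rfl; simp at hP; exact hp.ne_zero hP.symm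
  rw [Nat.card_eq_one_iff_unique]
  refine ⟨⟨fun I J => ?_⟩, ⟨⟨P ^ k, by rw [map_pow, hP]⟩⟩⟩
  have key : ∀ I : Ideal S, Ideal.absNorm I = p ^ k → I = P ^ k := by
    intro I hI
    have := dvd_span_pow hI
    rw [h, ← pow_mul] at this
    obtain ⟨i, -, hi⟩ := (dvd_prime_pow hPp _).1 this
    rw [associated_iff_eq] at hi
    subst hi
    rw [map_pow, hP] at hI
    rw [Nat.pow_right_injective hp.two_le hI]
  exact Subtype.ext ((key _ I.2).trans (key _ J.2).symm)

theorem card_absNorm_pow_of_inert [Module.Finite ℤ S] {p : ℕ} (hp : p.Prime) (hS : Module.finrank ℤ S = 2)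
    (h : Prime (Ideal.span {(p : S)})) (k : ℕ) :
    Nat.card {I : Ideal S // Ideal.absNorm I = p ^ k} = if Even k then 1 else 0 := by
  have hN : Ideal.absNorm (Ideal.span {(p : S)}) = p ^ 2 := by
    rw [Ideal.absNorm_span_singleton, show (p : S) = algebraMap ℤ S p by simp,
    Algebra.norm_algebraMap, Int.natAbs_pow, Int.natAbs_natCast, hS]
  have key : ∀ I : Ideal S, Ideal.absNorm I = p ^ k →
      ∃ i, k = 2 * i ∧ I = (Ideal.span {(p : S)}) ^ i := by
    intro I hI
    obtain ⟨i, -, hi⟩ := (dvd_prime_pow h _).1 (dvd_span_pow hI)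
    rw [associated_iff_eq] at hi
    subst hi
    rw [map_pow, hN, ← pow_mul] at hI
    exact ⟨i, (Nat.pow_right_injective hp.two_le hI).symm, rfl⟩
  split_ifs with hk
  · rw [Nat.card_eq_one_iff_unique]
    obtain ⟨j, rfl⟩ := hk
    refine ⟨⟨fun I J => ?_⟩, ⟨⟨(Ideal.span {(p : S)}) ^ j, by
      rw [map_pow, hN, ← pow_mul, two_mul]⟩⟩⟩
    obtain ⟨i, hi, hI⟩ := key _ I.2
    obtain ⟨i', hi', hJ⟩ := key _ J.2
    obtain rfl : i = i' := by omega
    exact Subtype.ext (hI.trans hJ.symm)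
  · rw [Nat.card_eq_zero]
    left
    refine ⟨fun I => hk ?_⟩
    obtain ⟨i, hi, -⟩ := key _ I.2
    exact ⟨i, by omega⟩

theorem card_absNorm_pow_of_split {p : ℕ} (hp : p.Prime) {P Q : Ideal S} (hPQ : P ≠ Q)
    (hP : Ideal.absNorm P = p) (hQ : Ideal.absNorm Q = p)
    (h : Ideal.span {(p : S)} = P * Q) (k : ℕ) :
    Nat.card {I : Ideal S // Ideal.absNorm I = p ^ k} = k + 1 := by
  have hprime : ∀ P : Ideal S, Ideal.absNorm P = p → Prime P := by
    intro P hP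
    refine Ideal.prime_of_isPrime ?_ (Ideal.isPrime_of_irreducible_absNorm (hP ▸ hp))
    rintro rfl; simp at hP; exact hp.ne_zero hP.symm
  have hPp := hprime P hP
  have hQp := hprime Q hQ
  rw [← Nat.card_fin (k + 1)]
  symm
  refine Nat.card_congr (Equiv.ofBijective
    (fun i : Fin (k + 1) => ⟨P ^ (i : ℕ) * Q ^ (k - i : ℕ), by
      rw [map_mul, map_pow, map_pow, hP, hQ, ← pow_add]
      congr 1; omega⟩) ⟨?_, ?_⟩)
  · have key : ∀ i j : ℕ, i < j → j ≤ k → P ^ i * Q ^ (k - i) ≠ P ^ j * Q ^ (k - j) := by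
      intro i j hij hjk he
      have h1 : P ^ i * Q ^ (k - i) = P ^ i * (P ^ (j - i) * Q ^ (k - j)) := by
        rw [he, ← mul_assoc, ← pow_add]; congr 2; omega
      have h2 := mul_left_cancel₀ (pow_ne_zero i hPp.ne_zero) h1
      have h3 : P ∣ Q ^ (k - i) := by
        rw [h2]; exact (dvd_pow_self _ (by omega)).mul_right _
      have h4 := hPp.dvd_of_dvd_pow h3
      exact hPQ (associated_iff_eq.1 (hPp.associated_of_dvd hQp h4))
    intro i j hij
    have hij : P ^ (i : ℕ) * Q ^ (k - i : ℕ) = P ^ (j : ℕ) * Q ^ (k - j : ℕ) :=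
      congrArg Subtype.val hij
    rcases lt_trichotomy (i : ℕ) j with hlt | heq | hgt
    · exact (key _ _ hlt (by omega) hij).elim
    · exact Fin.ext heq
    · exact (key _ _ hgt (by omega) hij.symm).elim
  · rintro ⟨I, hI⟩
    have := dvd_span_pow hI
    rw [h, mul_pow] at this
    obtain ⟨A, B, hA, hB, rfl⟩ := exists_dvd_and_dvd_of_dvd_mul this
    obtain ⟨i, hi, hA⟩ := (dvd_prime_pow hPp _).1 hA
    obtain ⟨j, hj, hB⟩ := (dvd_prime_pow hQp _).1 hB
    rw [associated_iff_eq] at hA hB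
    subst hA hB
    rw [map_mul, map_pow, map_pow, hP, hQ, ← pow_add] at hI
    have := Nat.pow_right_injective hp.two_le hI
    refine ⟨⟨i, by omega⟩, Subtype.ext ?_⟩
    simp only
    congr 2; omega

end IdealCount

end

section

open NumberField

namespace ImaginaryQuadratic

variable {K : Type*} [Field K] [NumberField K] {D : ℕ} {α : K}

theorem not_rational (hD : 0 < D) (hα : α ^ 2 = -(D : K)) (r : ℚ) : algebraMap ℚ K r ≠ α := by
  rintro rfl
  rw [← map_pow] at hα
  have : r ^ 2 = -(D : ℚ) := by
    apply (algebraMap ℚ K).injective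
    rw [hα]; simp
  have : (0 : ℚ) < D := by exact_mod_cast hD
  nlinarith [sq_nonneg r]

theorem exists_conj (hK : Module.finrank ℚ K = 2) (hD : 0 < D) (hα : α ^ 2 = -(D : K)) :
    ∃ σ : K ≃ₐ[ℚ] K, σ α = -α := by
  have : Algebra.IsQuadraticExtension ℚ K := ⟨hK⟩
  have : IsGalois ℚ K := inferInstance
  have hb : α ∉ (⊥ : IntermediateField ℚ K) := by
    rw [IntermediateField.mem_bot]
    rintro ⟨r, hr⟩
    exact not_rational hD hα r hr
  rw [IsGalois.mem_bot_iff_fixed] at hb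
  push Not at hb
  obtain ⟨σ, hσ⟩ := hb
  refine ⟨σ, ?_⟩
  have : (σ α) ^ 2 = α ^ 2 := by rw [← map_pow, hα]; simp
  exact (sq_eq_sq_iff_eq_or_eq_neg.1 this).resolve_left hσ

theorem exists_rat_repr (hK : Module.finrank ℚ K = 2) (hD : 0 < D) (hα : α ^ 2 = -(D : K)) (x : K) :
    ∃ r s : ℚ, x = r + s * α := by
  have hli : LinearIndependent ℚ ![(1 : K), α] := by
    rw [LinearIndependent.pair_iff' one_ne_zero]
    intro a ha
    exact not_rational hD hα a (by rw [← ha, Algebra.smul_def, mul_one])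
  have hsp := hli.span_eq_top_of_card_eq_finrank' (by simp [hK])
  have hx : x ∈ Submodule.span ℚ (Set.range ![(1 : K), α]) := hsp ▸ Submodule.mem_top
  rw [Matrix.range_cons, Matrix.range_cons, Matrix.range_empty, Set.union_empty, Set.singleton_union,
    Submodule.mem_span_pair] at hx
  obtain ⟨a, b, rfl⟩ := hx
  exact ⟨a, b, by simp [Algebra.smul_def]⟩

theorem isIntegral_half (hD4 : D % 4 = 3) (hα : α ^ 2 = -(D : K)) :
    IsIntegral ℤ ((1 + α) / 2) := by
  refine ⟨Polynomial.X ^ 2 - Polynomial.X + Polynomial.C (((D + 1) / 4 : ℕ) : ℤ), by monicity!, ?_⟩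
  obtain ⟨e, he⟩ : ∃ e, D + 1 = 4 * e := ⟨(D + 1) / 4, by omega⟩
  have : (D : K) + 1 = 4 * e := by exact_mod_cast he
  rw [he, Nat.mul_div_cancel_left _ (by norm_num)]
  simp only [Polynomial.eval₂_add, Polynomial.eval₂_sub, Polynomial.eval₂_pow, Polynomial.eval₂_X,
    Polynomial.eval₂_natCast, map_natCast]
  field_simp
  linear_combination hα - this

theorem exists_int_of_isIntegral {r : ℚ} (h : IsIntegral ℤ (r : K)) : ∃ n : ℤ, r = n := by
  have : IsIntegral ℤ r := by
    rw [← isIntegral_algebraMap_iff (algebraMap ℚ K).injective]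
    simpa using h
  obtain ⟨n, hn⟩ := IsIntegrallyClosed.isIntegral_iff.1 this
  exact ⟨n, by simpa using hn.symm⟩

/-- if `D` is squarefree and `D y ^ 2` is an integer then `y` is. -/
theorem exists_int_of_squarefree (hsf : Squarefree D) {y : ℚ} {n : ℤ} (h : D * y ^ 2 = n) :
    ∃ m : ℤ, y = m := by
  have h0 : (y.den : ℚ) ≠ 0 := by exact_mod_cast y.den_ne_zero
  have h1 : (D : ℤ) * y.num ^ 2 = n * y.den ^ 2 := by
    have : (D : ℚ) * y.num ^ 2 = n * y.den ^ 2 := by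
      rw [← h]; nth_rw 2 [← Rat.num_div_den y]; field_simp
    exact_mod_cast this
  have h2 : (y.den : ℤ) ^ 2 ∣ D := by
    have hc : IsCoprime ((y.den : ℤ) ^ 2) (y.num ^ 2) := by
      refine IsCoprime.pow (Int.isCoprime_iff_gcd_eq_one.2 ?_)
      rw [Int.gcd_comm]; exact y.reduced
    exact hc.dvd_of_dvd_mul_right (h1 ▸ Dvd.intro_left _ rfl)
  have h3 : y.den * y.den ∣ D := by
    rw [← sq]; exact_mod_cast h2
  have h4 := Nat.isUnit_iff.1 (hsf _ h3)
  exact ⟨y.num, (Rat.coe_int_num_of_den_eq_one h4).symm⟩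

theorem exists_half_int_repr (hK : Module.finrank ℚ K = 2) (hD : 0 < D) (hsf : Squarefree D)
    (hα : α ^ 2 = -(D : K)) {x : K} (hx : IsIntegral ℤ x) :
    ∃ u v : ℤ, 2 * x = u + v * α ∧ (4 : ℤ) ∣ u ^ 2 + D * v ^ 2 ∧
      ∀ σ : K ≃ₐ[ℚ] K, σ α = - α → 4 * (x * σ x) = ((u ^ 2 + D * v ^ 2 : ℤ) : K) := by
  obtain ⟨r, s, rfl⟩ := exists_rat_repr hK hD hα x
  obtain ⟨σ, hσ⟩ := exists_conj hK hD hα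
  have hx' : ∀ σ : K ≃ₐ[ℚ] K, σ α = -α → σ (r + s * α) = r - s * α := by
    intro σ hσ; simp [hσ]; ring
  have hi : IsIntegral ℤ ((r : K) - s * α) := by
    rw [← hx' σ hσ]
    exact hx.map (σ.toAlgHom.restrictScalars ℤ)
  obtain ⟨u, hu⟩ : ∃ u : ℤ, 2 * r = u := by
    apply exists_int_of_isIntegral (K := K)
    rw [show ((2 * r : ℚ) : K) = (r + s * α) + (r - s * α) by push_cast; ring]
    exact hx.add hi
  obtain ⟨w, hw⟩ : ∃ w : ℤ, r ^ 2 + D * s ^ 2 = w := by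
    apply exists_int_of_isIntegral (K := K)
    rw [show ((r ^ 2 + D * s ^ 2 : ℚ) : K) = (r + s * α) * (r - s * α) by
      push_cast; linear_combination (s : K) ^ 2 * hα]
    exact hx.mul hi
  obtain ⟨v, hv⟩ : ∃ v : ℤ, 2 * s = v := by
    apply exists_int_of_squarefree hsf (n := 4 * w - u ^ 2)
    push_cast
    rw [← hw, ← hu]; ring
  have h4 : u ^ 2 + D * v ^ 2 = 4 * w := by
    have : (u ^ 2 + D * v ^ 2 : ℚ) = 4 * w := by rw [← hw, ← hu, ← hv]; ring
    exact_mod_cast this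
  refine ⟨u, v, ?_, ⟨w, h4⟩, ?_⟩
  · rw [← Rat.cast_intCast u, ← Rat.cast_intCast v, ← hu, ← hv]; push_cast; ring
  · intro σ hσ
    rw [hx' σ hσ, h4]
    push_cast
    rw [← Rat.cast_intCast w, ← hw]; push_cast
    linear_combination - 4 * (s : K) ^ 2 * hα

theorem exists_theta (hD4 : D % 4 = 3) (hα : α ^ 2 = -(D : K)) :
    ∃ θ : 𝓞 K, 2 * algebraMap (𝓞 K) K θ = 1 + α ∧ θ ^ 2 = θ - (((D + 1) / 4 : ℕ) : 𝓞 K) := by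
  obtain ⟨θ, hθ⟩ : ∃ θ : 𝓞 K, algebraMap (𝓞 K) K θ = (1 + α) / 2 := ⟨⟨_, isIntegral_half hD4 hα⟩, rfl⟩
  refine ⟨θ, by rw [hθ]; ring, ?_⟩
  obtain ⟨e, he⟩ : ∃ e, D + 1 = 4 * e := ⟨(D + 1) / 4, by omega⟩
  have : (D : K) + 1 = 4 * e := by exact_mod_cast he
  rw [he, Nat.mul_div_cancel_left _ (by norm_num)]
  apply RingOfIntegers.coe_injective
  rw [map_pow, map_sub, hθ, map_natCast]
  field_simp
  linear_combination hα - this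

theorem exists_theta_repr (hK : Module.finrank ℚ K = 2) (hD : 0 < D) (hsf : Squarefree D)
    (hD4 : D % 4 = 3) (hα : α ^ 2 = -(D : K)) {θ : 𝓞 K} (hθ : 2 * algebraMap (𝓞 K) K θ = 1 + α) (x : 𝓞 K) :
    ∃ u v : ℤ, x = u + v * θ := by
  obtain ⟨u, v, h, h4, -⟩ := exists_half_int_repr hK hD hsf hα x.isIntegral_coe
  have h2 : (2 : ℤ) ∣ u - v := by
    obtain ⟨e, he⟩ : ∃ e : ℤ, (D : ℤ) = 4 * e + 3 := ⟨D / 4, by omega⟩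
    obtain ⟨k, hk⟩ := h4
    have : (2 : ℤ) ∣ (u - v) ^ 2 := ⟨2 * k - u * v - 2 * e * v ^ 2 - v ^ 2, by
      rw [he] at hk; linear_combination hk⟩
    exact Int.prime_two.dvd_of_dvd_pow this
  obtain ⟨w, hw⟩ := h2
  have hw' : (u : K) - v = 2 * w := by exact_mod_cast hw
  refine ⟨w, v, ?_⟩
  ext
  simp only [map_add, map_mul, map_intCast]
  have : (2 : K) * x = 2 * (w + v * θ) := by
    linear_combination h + hw' - v * hθ
  exact mul_left_cancel₀ two_ne_zero this

theorem theta_unique (hD : 0 < D) (hα : α ^ 2 = -(D : K)) {θ : 𝓞 K} (hθ : 2 * algebraMap (𝓞 K) K θ = 1 + α)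
    {u v : ℤ} (h : (u : 𝓞 K) + v * θ = 0) : u = 0 ∧ v = 0 := by
  have h' : (u : K) + v * θ = 0 := by
    have := congrArg (algebraMap (𝓞 K) K) h
    simpa using this
  have hv : v = 0 := by
    by_contra hv
    refine not_rational hD hα (-(2 * u + v) / v) ?_
    have hv' : (v : K) ≠ 0 := by exact_mod_cast hv
    simp only [map_div₀, map_neg, map_add, map_mul, map_ofNat, map_intCast]
    rw [div_eq_iff hv']
    linear_combination  -2 * h' + v * hθ
  subst hv
  simpa using h'

end ImaginaryQuadratic

end

section

open NumberField

namespace ImaginaryQuadratic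

variable {K : Type*} [Field K] [NumberField K] {D : ℕ} {α : K}

theorem discr_eq (hK : Module.finrank ℚ K = 2) (hsf : Squarefree D)
    (hD4 : D % 4 = 3) (hα : α ^ 2 = -(D : K)) : discr K = -D := by
  have hD : 0 < D := by omega
  obtain ⟨θ, hθ, hθ2⟩ := exists_theta hD4 hα
  have hli : LinearIndependent ℤ ![(1 : 𝓞 K), θ] := by
    rw [LinearIndependent.pair_iff]
    intro s t h
    exact theta_unique hD hα hθ (by simpa using h)
  have hsp : ⊤ ≤ Submodule.span ℤ (Set.range ![(1 : 𝓞 K), θ]) := by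
    intro x _
    rw [Matrix.range_cons, Matrix.range_cons, Matrix.range_empty, Set.union_empty,
      Set.singleton_union, Submodule.mem_span_pair]
    obtain ⟨u, v, rfl⟩ := exists_theta_repr hK hD hsf hD4 hα hθ x
    exact ⟨u, v, by simp⟩
  let b : Module.Basis (Fin 2) ℤ (𝓞 K) := Module.Basis.mk hli hsp
  have b0 : b 0 = 1 := by simp [b]
  have b1 : b 1 = θ := by simp [b]
  have t1 : Algebra.trace ℤ (𝓞 K) 1 = 2 := by
    rw [← map_one (algebraMap ℤ (𝓞 K)), Algebra.trace_algebraMap, RingOfIntegers.rank, hK]; simp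
  have tθ : Algebra.trace ℤ (𝓞 K) θ = 1 := by
    rw [Algebra.trace_eq_matrix_trace b, Matrix.trace_fin_two, Algebra.leftMulMatrix_eq_repr_mul,
      Algebra.leftMulMatrix_eq_repr_mul, b0, b1, mul_one, ← sq, hθ2]
    have h1 : θ - (((D + 1) / 4 : ℕ) : 𝓞 K) = b 1 - (((D + 1) / 4 : ℕ) : ℤ) • b 0 := by
      rw [b0, b1, zsmul_eq_mul, Int.cast_natCast, mul_one]
    rw [h1, ← b1, map_sub, map_smul, b.repr_self, b.repr_self]
    simp
  rw [← discr_eq_discr K b, Algebra.discr_def, Matrix.det_fin_two]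
  simp only [Algebra.traceMatrix_apply, Algebra.traceForm_apply, b0, b1, mul_one, one_mul, ← sq,
    hθ2, map_sub, tθ]
  rw [one_pow, t1]
  have h2 : Algebra.trace ℤ (𝓞 K) (((D + 1) / 4 : ℕ) : 𝓞 K) = ((D + 1) / 4 : ℕ) * 2 := by
    rw [← map_natCast (algebraMap ℤ (𝓞 K)), Algebra.trace_algebraMap, RingOfIntegers.rank, hK]
    simp [mul_comm]
  rw [h2]
  push_cast
  omega

theorem torsion_eq_two (hK : Module.finrank ℚ K = 2) (hsf : Squarefree D)
    (hD4 : D % 4 = 3) (hD3 : 4 < D) (hα : α ^ 2 = -(D : K)) : Units.torsionOrder K = 2 := by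
  have hD : 0 < D := by omega
  have hle : Units.torsionOrder K ≤ 2 := by
    have hs : ∀ u : Units.torsion K, (u : (𝓞 K)ˣ) ∈ ({1, -1} : Set (𝓞 K)ˣ) := by
      rintro ⟨u, hu⟩
      rw [Units.torsion, CommGroup.mem_torsion, isOfFinOrder_iff_pow_eq_one] at hu
      obtain ⟨n, hn, hun⟩ := hu
      set x : K := algebraMap (𝓞 K) K u with hx
      have hxn : x ^ n = 1 := by
        rw [hx, ← map_pow, ← Units.val_pow_eq_pow_val, hun]; simp
      obtain ⟨a, b, h1, ⟨w, hw⟩, h3⟩ := exists_half_int_repr hK hD hsf hα (u : 𝓞 K).isIntegral_coe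
      obtain ⟨σ, hσ⟩ := exists_conj hK hD hα
      have h3 := h3 σ hσ
      have h4 : x * σ x = w := by
        rw [hw] at h3; push_cast at h3
        exact mul_left_cancel₀ (by norm_num) h3
      have h5 : w ^ n = 1 := by
        have : (w : K) ^ n = 1 := by rw [← h4, mul_pow, hxn, ← map_pow σ, hxn, map_one, one_mul]
        exact_mod_cast this
      have hw0 : 0 ≤ w := by nlinarith [sq_nonneg a, sq_nonneg b]
      have hw1 : w = 1 := (pow_eq_one_iff_of_nonneg hw0 hn.ne').1 h5
      have hb : b = 0 := by
        by_contra hb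
        have : 0 < b ^ 2 := by positivity
        have : (4 : ℤ) < D := by exact_mod_cast hD3
        nlinarith [sq_nonneg a]
      subst hb; subst hw1
      have ha : (a - 2) * (a + 2) = 0 := by linear_combination hw
      rcases mul_eq_zero.1 ha with h | h
      · left
        obtain rfl : a = 2 := by omega
        have : x = 1 := by
          apply mul_left_cancel₀ (two_ne_zero (α := K)); rw [h1]; norm_num
        exact Units.ext (RingOfIntegers.coe_injective (this.trans (map_one _).symm))
      · right
        obtain rfl : a = -2 := by omega
        have : x = -1 := by
          apply mul_left_cancel₀ (two_ne_zero (α := K)); rw [h1]; norm_num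
        rw [Set.mem_singleton_iff]
        exact Units.ext (RingOfIntegers.coe_injective (by simpa using this))
    have hinj : Function.Injective (fun u : Units.torsion K =>
        (⟨u, hs u⟩ : ({1, -1} : Set (𝓞 K)ˣ))) := by
      intro u v h
      exact Subtype.ext (Subtype.mk.inj h)
    refine (Nat.card_le_card_of_injective _ hinj).trans ?_
    rw [Nat.card_coe_set_eq]
    exact (Set.ncard_insert_le _ _).trans (by simp)
  obtain ⟨k, hk⟩ := Units.even_torsionOrder K
  have := Units.torsionOrder_pos K
  omega

theorem nrRealPlaces_eq (hD : 0 < D) (hα : α ^ 2 = -(D : K)) :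
    InfinitePlace.nrRealPlaces K = 0 := by
  rw [NumberField.nrRealPlaces_eq_zero_iff]
  refine ⟨fun v => ?_⟩
  rw [← InfinitePlace.not_isReal_iff_isComplex]
  intro hv
  have h1 : (InfinitePlace.embedding_of_isReal hv α) ^ 2 = -(D : ℝ) := by
    rw [← map_pow, hα]; simp
  have : (0 : ℝ) < D := by exact_mod_cast hD
  nlinarith [sq_nonneg (InfinitePlace.embedding_of_isReal hv α)]

theorem residue_eq (hK : Module.finrank ℚ K = 2) (hsf : Squarefree D)
    (hD4 : D % 4 = 3) (hD3 : 4 < D) (hα : α ^ 2 = -(D : K)) :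
    dedekindZeta_residue K = Real.pi * classNumber K / Real.sqrt D := by
  have h0 := nrRealPlaces_eq (by omega) hα
  have h1 : InfinitePlace.nrComplexPlaces K = 1 := by
    have := InfinitePlace.card_add_two_mul_card_eq_rank K
    omega
  have hrk : Units.rank K = 0 := by
    rw [Units.rank, InfinitePlace.card_eq_nrRealPlaces_add_nrComplexPlaces, h0, h1]
  have hreg : Units.regulator K = 1 := by
    have hc : Fintype.card (InfinitePlace K) = 1 := by
      rw [InfinitePlace.card_eq_nrRealPlaces_add_nrComplexPlaces, h0, h1]
    obtain ⟨w, hw⟩ := Fintype.card_eq_one_iff.1 hc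
    have hE : IsEmpty {w' : InfinitePlace K // w' ≠ w} := ⟨fun x => x.2 (hw _)⟩
    have : IsEmpty (Fin (Units.rank K)) := by rw [hrk]; infer_instance
    have e : {w' : InfinitePlace K // w' ≠ w} ≃ Fin (Units.rank K) := Equiv.equivOfIsEmpty _ _
    rw [Units.regulator_eq_det K w e]
    simp
  rw [dedekindZeta_residue_def, h0, h1, hreg, torsion_eq_two hK hsf hD4 hD3 hα,
    discr_eq hK hsf hD4 hα]
  simp
  field_simp

end ImaginaryQuadratic

end

section

open NumberField

namespace ImaginaryQuadratic

theorem exists_root_iff_jacobiSym {D ℓ : ℕ} (hD4 : D % 4 = 3) (hℓ : ℓ.Prime) (hℓD : ¬ ℓ ∣ D) :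
    (∃ t : ℤ, (ℓ : ℤ) ∣ t ^ 2 - t + ((D + 1) / 4 : ℕ)) ↔ jacobiSym ℓ D = 1 := by
  obtain ⟨e, he⟩ : ∃ e, D + 1 = 4 * e := ⟨(D + 1) / 4, by omega⟩
  have he' : (D + 1) / 4 = e := by omega
  have heZ : (D : ℤ) = 4 * e - 1 := by have : (D : ℤ) + 1 = 4 * e := by exact_mod_cast he
                                       linarith
  rw [he']
  rcases hℓ.eq_two_or_odd' with rfl | hodd
  · rw [Nat.cast_ofNat, jacobiSym.at_two (Nat.odd_iff.2 (by omega)), ZMod.χ₈_nat_eq_if_mod_eight]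
    have h1 : ∀ t : ℤ, (2 : ℤ) ∣ t ^ 2 - t := fun t => by
      have := Int.even_mul_pred_self t
      rw [even_iff_two_dvd] at this
      rwa [show t ^ 2 - t = t * (t - 1) by ring]
    constructor
    · rintro ⟨t, ht⟩
      have h2 : (2 : ℤ) ∣ e := by simpa using dvd_sub ht (h1 t)
      rw [if_neg (by omega), if_pos (by omega)]
    · intro h
      refine ⟨0, ?_⟩
      rw [if_neg (by omega)] at h
      split_ifs at h with h2
      simp; omega
  · have : Fact ℓ.Prime := ⟨hℓ⟩
    have hDo : Odd D := Nat.odd_iff.2 (by omega)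
    have h1 : jacobiSym ℓ D = legendreSym ℓ (-D : ℤ) := by
      rw [jacobiSym.legendreSym.to_jacobiSym, jacobiSym.neg _ hodd, jacobiSym.quadratic_reciprocity hodd hDo,
        ZMod.χ₄_eq_neg_one_pow (Nat.odd_iff.1 hodd), pow_mul, mul_comm (_ ^ _), mul_comm _ (jacobiSym _ _)]
      congr 1
      rw [← pow_mul, mul_comm, pow_mul, Odd.neg_one_pow (Nat.odd_iff.2 (by omega))]
    have h0 : ((-D : ℤ) : ZMod ℓ) ≠ 0 := by
      rw [Int.cast_neg, neg_ne_zero, Int.cast_natCast, Ne, ZMod.natCast_eq_zero_iff]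
      exact hℓD
    rw [h1, legendreSym.eq_one_iff ℓ h0]
    have hd : ∀ x : ℤ, (ℓ : ℤ) ∣ 4 * x → (ℓ : ℤ) ∣ x := fun x hx => by
      refine IsCoprime.dvd_of_dvd_mul_left ?_ hx
      have : Nat.Coprime ℓ (2 ^ 2) := Nat.Coprime.pow_right _ (Nat.coprime_two_right.2 hodd)
      exact_mod_cast Nat.isCoprime_iff_coprime.2 this
    constructor
    · rintro ⟨t, ht⟩
      refine ⟨((2 * t - 1 : ℤ) : ZMod ℓ), ?_⟩
      rw [← Int.cast_mul, ZMod.intCast_eq_intCast_iff_dvd_sub]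
      have := ht.mul_left 4
      rwa [show 4 * (t ^ 2 - t + (e : ℤ)) = (2 * t - 1) * (2 * t - 1) - -(D : ℤ) by
        rw [heZ]; ring] at this
    · rintro ⟨s, hs⟩
      obtain ⟨s, rfl⟩ := ZMod.intCast_surjective s
      obtain ⟨s', hs', hs2⟩ : ∃ s' : ℤ, (s' : ZMod ℓ) = s ∧ s' % 2 = 1 := by
        rcases Int.emod_two_eq_zero_or_one s with h | h
        · refine ⟨s + ℓ, by simp, ?_⟩
          have := Nat.odd_iff.1 hodd
          omega
        · exact ⟨s, rfl, h⟩
      obtain ⟨t, rfl⟩ : ∃ t, s' = 2 * t - 1 := ⟨(s' + 1) / 2, by omega⟩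
      rw [← hs', ← Int.cast_mul, ZMod.intCast_eq_intCast_iff_dvd_sub] at hs
      refine ⟨t, hd _ ?_⟩
      rwa [show (2 * t - 1) * (2 * t - 1) - -(D : ℤ) = 4 * (t ^ 2 - t + (e : ℤ)) by
        rw [heZ]; ring] at hs

variable {K : Type*} [Field K] [NumberField K] {D : ℕ} {α : K}

theorem absNorm_span_natCast (hK : Module.finrank ℚ K = 2) (ℓ : ℕ) :
    Ideal.absNorm (Ideal.span {(ℓ : 𝓞 K)}) = ℓ ^ 2 := by
  rw [Ideal.absNorm_span_singleton, ← map_natCast (algebraMap ℤ (𝓞 K)), Algebra.norm_algebraMap,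
    RingOfIntegers.rank, hK, Int.natAbs_pow, Int.natAbs_natCast]

theorem eq_top_of_intCast_mem {P : Ideal (𝓞 K)} {ℓ : ℕ} (hℓ : ℓ.Prime) (h : (ℓ : 𝓞 K) ∈ P) {a : ℤ}
    (ha : (a : 𝓞 K) ∈ P) (hd : ¬ (ℓ : ℤ) ∣ a) : P = ⊤ := by
  obtain ⟨x, y, hxy⟩ := (Prime.coprime_iff_not_dvd (Nat.prime_iff_prime_int.1 hℓ)).2 hd
  rw [Ideal.eq_top_iff_one]
  have : (1 : 𝓞 K) = x * ℓ + y * a := by exact_mod_cast congrArg (Int.cast (R := 𝓞 K)) hxy.symm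
  rw [this]
  exact P.add_mem (P.mul_mem_left _ h) (P.mul_mem_left _ ha)

theorem exists_ramified (hK : Module.finrank ℚ K = 2) (hsf : Squarefree D)
    (hD4 : D % 4 = 3) (hα : α ^ 2 = -(D : K)) {ℓ : ℕ} (hℓ : ℓ.Prime) (hℓD : ℓ ∣ D) :
    ∃ P : Ideal (𝓞 K), Ideal.absNorm P = ℓ ∧ Ideal.span {(ℓ : 𝓞 K)} = P ^ 2 := by
  obtain ⟨α', hα'⟩ : ∃ β : 𝓞 K, β ^ 2 = -(D : 𝓞 K) := by
    obtain ⟨θ, hθ, -⟩ := exists_theta hD4 hα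
    refine ⟨2 * θ - 1, RingOfIntegers.coe_injective ?_⟩
    rw [map_pow, map_sub, map_mul, map_ofNat, hθ, map_neg, map_natCast, ← hα, map_one]; ring
  obtain ⟨d, rfl⟩ := hℓD
  have hcop : Nat.Coprime ℓ d := by
    rw [Nat.Prime.coprime_iff_not_dvd hℓ]
    rintro ⟨c, rfl⟩
    exact hℓ.not_isUnit (hsf ℓ ⟨c, by ring⟩)
  obtain ⟨x, y, hxy⟩ := Nat.isCoprime_iff_coprime.2 hcop
  have hxy' : (x : 𝓞 K) * ℓ + y * d = 1 := by exact_mod_cast congrArg (Int.cast (R := 𝓞 K)) hxy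
  have key : Ideal.span {(ℓ : 𝓞 K)} = (Ideal.span {(ℓ : 𝓞 K), α'}) ^ 2 := by
    push_cast at hα'
    rw [sq, Ideal.span_pair_mul_span_pair]
    apply le_antisymm
    · rw [Ideal.span_singleton_le_iff_mem]
      have : (ℓ : 𝓞 K) = x * (ℓ * ℓ) + (-y) * (α' * α') := by
        linear_combination -(ℓ : 𝓞 K) * hxy' + y * hα'
      refine Set.mem_of_eq_of_mem this (Ideal.add_mem _
        (Ideal.mul_mem_left _ _ (Ideal.subset_span (by simp)))
        (Ideal.mul_mem_left _ _ (Ideal.subset_span (by simp))))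
    · rw [Ideal.span_le]
      rintro z (rfl | rfl | rfl | rfl)
      all_goals rw [SetLike.mem_coe, Ideal.mem_span_singleton]
      · exact ⟨ℓ, rfl⟩
      · exact ⟨α', rfl⟩
      · exact ⟨α', mul_comm _ _⟩
      · exact ⟨-d, by linear_combination hα'⟩
  refine ⟨_, ?_, key⟩
  have := absNorm_span_natCast hK ℓ
  rw [key, map_pow] at this
  exact Nat.pow_left_injective (n := 2) two_ne_zero this

theorem exists_split (hK : Module.finrank ℚ K = 2) (hsf : Squarefree D)
    (hD4 : D % 4 = 3) (hα : α ^ 2 = -(D : K)) {ℓ : ℕ} (hℓ : ℓ.Prime) (hℓD : ¬ ℓ ∣ D)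
    {t : ℤ} (ht : (ℓ : ℤ) ∣ t ^ 2 - t + ((D + 1) / 4 : ℕ)) :
    ∃ P Q : Ideal (𝓞 K), P ≠ Q ∧ Ideal.absNorm P = ℓ ∧ Ideal.absNorm Q = ℓ ∧
      Ideal.span {(ℓ : 𝓞 K)} = P * Q := by
  have hD : 0 < D := by omega
  obtain ⟨θ, hθ, hθ2⟩ := exists_theta hD4 hα
  obtain ⟨e, he⟩ : ∃ e, D + 1 = 4 * e := ⟨(D + 1) / 4, by omega⟩
  have he' : (D + 1) / 4 = e := by omega
  have heZ : (D : ℤ) = 4 * e - 1 := by have : (D : ℤ) + 1 = 4 * e := by exact_mod_cast he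
                                       linarith
  rw [he'] at ht hθ2
  obtain ⟨m, hm⟩ := ht
  have hm' : (t : 𝓞 K) ^ 2 - t + e = ℓ * m := by exact_mod_cast congrArg (Int.cast (R := 𝓞 K)) hm
  have hnd : ¬ (ℓ : ℤ) ∣ 2 * t - 1 := by
    intro h
    have h1 : (ℓ : ℤ) ∣ D := by
      have : (D : ℤ) = 4 * (ℓ * m) - (2 * t - 1) * (2 * t - 1) := by rw [← hm, heZ]; ring
      rw [this]
      exact dvd_sub (Dvd.intro _ rfl |>.mul_left _) (h.mul_right _)
    exact hℓD (by exact_mod_cast h1)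
  set P := Ideal.span {(ℓ : 𝓞 K), θ - t} with hP
  set Q := Ideal.span {(ℓ : 𝓞 K), θ - (1 - t)} with hQ
  have hlP : (ℓ : 𝓞 K) ∈ P := Ideal.subset_span (by simp)
  have htP : θ - t ∈ P := Ideal.subset_span (by simp)
  have htQ : θ - (1 - t) ∈ Q := Ideal.subset_span (by simp)
  have hlQ : (ℓ : 𝓞 K) ∈ Q := Ideal.subset_span (by simp)
  have key : Ideal.span {(ℓ : 𝓞 K)} = P * Q := by
    apply le_antisymm
    · obtain ⟨x, y, hxy⟩ := (Prime.coprime_iff_not_dvd (Nat.prime_iff_prime_int.1 hℓ)).2 hnd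
      have hxy' : (x : 𝓞 K) * ℓ + y * (2 * t - 1) = 1 := by
        exact_mod_cast congrArg (Int.cast (R := 𝓞 K)) hxy
      rw [Ideal.span_singleton_le_iff_mem]
      have : (ℓ : 𝓞 K) = x * (ℓ * ℓ) + (y * (ℓ * (θ - (1 - t))) + (-y) * ((θ - t) * ℓ)) := by
        linear_combination -(ℓ : 𝓞 K) * hxy'
      rw [this]
      exact Ideal.add_mem _ (Ideal.mul_mem_left _ _ (Ideal.mul_mem_mul hlP hlQ))
        (Ideal.add_mem _ (Ideal.mul_mem_left _ _ (Ideal.mul_mem_mul hlP htQ))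
          (Ideal.mul_mem_left _ _ (Ideal.mul_mem_mul htP hlQ)))
    · rw [hP, hQ, Ideal.span_pair_mul_span_pair, Ideal.span_le]
      rintro z (rfl | rfl | rfl | rfl)
      all_goals rw [SetLike.mem_coe, Ideal.mem_span_singleton]
      · exact ⟨_, rfl⟩
      · exact ⟨_, rfl⟩
      · exact ⟨_, mul_comm _ _⟩
      · exact ⟨-m, by linear_combination hθ2 - hm'⟩
  have hdiv : ∀ s : ℤ, ¬ (ℓ : 𝓞 K) ∣ θ - s := by
    rintro s ⟨w, hw⟩
    obtain ⟨u, v, rfl⟩ : ∃ u v : ℤ, w = u + v * θ :=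
      exists_theta_repr hK hD hsf hD4 hα hθ w
    have := (theta_unique hD hα hθ (u := -s - ℓ * u) (v := 1 - ℓ * v)
      (by push_cast; linear_combination hw)).2
    have h1 : (ℓ : ℤ) ∣ 1 := ⟨v, by linarith⟩
    exact hℓ.not_isUnit (by simpa [Int.isUnit_iff] using isUnit_of_dvd_one h1)
  have hPt : P ≠ ⊤ := by
    intro h
    rw [h, Ideal.top_mul] at key
    rw [← key, Ideal.mem_span_singleton] at htQ
    exact hdiv (1 - t) (by exact_mod_cast htQ)
  have hQt : Q ≠ ⊤ := by
    intro h
    rw [h, Ideal.mul_top] at key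
    rw [← key, Ideal.mem_span_singleton] at htP
    exact hdiv t htP
  have hn := absNorm_span_natCast hK ℓ
  rw [key, map_mul] at hn
  have hP1 : Ideal.absNorm P ≠ 1 := by rwa [Ne, Ideal.absNorm_eq_one_iff]
  have hQ1 : Ideal.absNorm Q ≠ 1 := by rwa [Ne, Ideal.absNorm_eq_one_iff]
  obtain ⟨h1, h2⟩ := (Nat.Prime.mul_eq_prime_sq_iff hℓ hP1 hQ1).1 hn
  refine ⟨P, Q, ?_, h1, h2, key⟩
  intro h
  refine hPt (eq_top_of_intCast_mem hℓ hlP (a := 2 * t - 1) ?_ hnd)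
  have := P.sub_mem (h ▸ htQ : θ - (1 - t) ∈ P) htP
  convert this using 1
  push_cast; ring

theorem prime_span_of_inert (hK : Module.finrank ℚ K = 2)
    (hD4 : D % 4 = 3) (hα : α ^ 2 = -(D : K)) {ℓ : ℕ} (hℓ : ℓ.Prime)
    (ht : ¬ ∃ t : ℤ, (ℓ : ℤ) ∣ t ^ 2 - t + ((D + 1) / 4 : ℕ)) :
    Prime (Ideal.span {(ℓ : 𝓞 K)}) := by
  obtain ⟨θ, hθ, hθ2⟩ := exists_theta hD4 hα
  generalize (D + 1) / 4 = e at ht hθ2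
  have hn := absNorm_span_natCast hK ℓ
  have h1 : Ideal.span {(ℓ : 𝓞 K)} ≠ ⊤ := by
    intro h
    rw [h, Ideal.absNorm_top] at hn
    exact hℓ.ne_one (by simpa using hn.symm)
  obtain ⟨P, hPm, hle⟩ := Ideal.exists_le_maximal _ h1
  obtain ⟨J, hJ⟩ := Ideal.dvd_iff_le.2 hle
  have hlP : (ℓ : 𝓞 K) ∈ P := hle (Ideal.mem_span_singleton_self _)
  have hP0 : P ≠ ⊥ := by
    rintro rfl
    rw [Ideal.mem_bot] at hlP
    exact hℓ.ne_zero (by exact_mod_cast hlP)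
  have hP1 : Ideal.absNorm P ≠ 1 := by
    rw [Ne, Ideal.absNorm_eq_one_iff]; exact hPm.ne_top
  by_cases hJ1 : Ideal.absNorm J = 1
  · rw [Ideal.absNorm_eq_one_iff] at hJ1
    rw [hJ, hJ1, Ideal.mul_top]
    exact Ideal.prime_of_isPrime hP0 hPm.isPrime
  · rw [hJ, map_mul] at hn
    obtain ⟨h2, -⟩ := (Nat.Prime.mul_eq_prime_sq_iff hℓ hP1 hJ1).1 hn
    exfalso
    have hc : Nat.card (𝓞 K ⧸ P) = ℓ := h2
    have : Fact ℓ.Prime := ⟨hℓ⟩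
    have hfin : Finite (𝓞 K ⧸ P) := Nat.finite_of_card_ne_zero (hc ▸ hℓ.ne_zero)
    have : Fintype (𝓞 K ⧸ P) := Fintype.ofFinite _
    have hc' : Fintype.card (𝓞 K ⧸ P) = ℓ := by rw [← Nat.card_eq_fintype_card, hc]
    let φ := ZMod.ringEquivOfPrime (𝓞 K ⧸ P) hℓ hc'
    obtain ⟨z, hz⟩ := φ.surjective (Ideal.Quotient.mk P θ)
    obtain ⟨t, rfl⟩ := ZMod.intCast_surjective z
    rw [map_intCast, ← map_intCast (Ideal.Quotient.mk P)] at hz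
    refine hPm.ne_top (eq_top_of_intCast_mem hℓ hlP (a := t ^ 2 - t + e) ?_ ?_)
    · rw [← Ideal.Quotient.eq_zero_iff_mem]
      push_cast
      rw [map_add, map_sub, map_pow, hz, ← map_pow, hθ2]
      simp
    · exact fun h => ht ⟨t, h⟩

theorem card_absNorm_prime_pow (hK : Module.finrank ℚ K = 2) (hsf : Squarefree D)
    (hD4 : D % 4 = 3) (hα : α ^ 2 = -(D : K)) {ℓ : ℕ} (hℓ : ℓ.Prime) (k : ℕ) :
    (Nat.card {I : Ideal (𝓞 K) // Ideal.absNorm I = ℓ ^ k} : ℤ) =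
      ∑ j ∈ Finset.range (k + 1), jacobiSym ℓ D ^ j := by
  have hD : D ≠ 0 := by omega
  by_cases hℓD : ℓ ∣ D
  · obtain ⟨P, hP, h⟩ := exists_ramified hK hsf hD4 hα hℓ hℓD
    rw [IdealCount.card_absNorm_pow_of_ramified hℓ hP h]
    have : jacobiSym ℓ D = 0 := by
      rw [jacobiSym.eq_zero_iff]
      refine ⟨hD, ?_⟩
      rw [Int.gcd_natCast_natCast]
      exact fun h => hℓ.ne_one (Nat.eq_one_of_dvd_one (h ▸ Nat.dvd_gcd dvd_rfl hℓD))
    rw [this, Finset.sum_range_succ', Finset.sum_eq_zero] <;> simp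
  · by_cases ht : ∃ t : ℤ, (ℓ : ℤ) ∣ t ^ 2 - t + ((D + 1) / 4 : ℕ)
    · rw [(exists_root_iff_jacobiSym hD4 hℓ hℓD).1 ht]
      obtain ⟨t, ht⟩ := ht
      obtain ⟨P, Q, hPQ, hP, hQ, h⟩ := exists_split hK hsf hD4 hα hℓ hℓD ht
      rw [IdealCount.card_absNorm_pow_of_split hℓ hPQ hP hQ h]
      simp
    · have h1 : jacobiSym ℓ D = -1 := by
        have hc : Int.gcd ℓ D = 1 := by
          rw [Int.gcd_natCast_natCast]; exact (Nat.Prime.coprime_iff_not_dvd hℓ).2 hℓD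
        rcases jacobiSym.eq_one_or_neg_one hc with h | h
        · exact absurd ((exists_root_iff_jacobiSym hD4 hℓ hℓD).2 h) ht
        · exact h
      rw [h1, IdealCount.card_absNorm_pow_of_inert hℓ (by rw [RingOfIntegers.rank, hK])
        (prime_span_of_inert hK hD4 hα hℓ ht)]
      rw [neg_one_geom_sum]
      simp only [Nat.even_add_one]
      split_ifs <;> simp_all

end ImaginaryQuadratic

end

section

open NumberField

/-- The Dirichlet character modulo `D` given by the Jacobi symbol `n ↦ (n / D)`. -/
noncomputable def jacobiChar (D : ℕ) [NeZero D] : DirichletCharacter ℂ D where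
  toFun x := ((jacobiSym x.val D : ℤ) : ℂ)
  map_one' := by
    have : jacobiSym ((1 : ZMod D).val : ℤ) D = 1 := by
      rw [jacobiSym.mod_left, ZMod.val_one_eq_one_mod, Int.natCast_mod, Int.emod_emod_of_dvd _ dvd_rfl,
        ← jacobiSym.mod_left]
      exact jacobiSym.one_left D
    rw [this, Int.cast_one]
  map_mul' x y := by
    rw [ZMod.val_mul, Int.natCast_mod, ← jacobiSym.mod_left, Nat.cast_mul, jacobiSym.mul_left,
      Int.cast_mul]
  map_nonunit' x hx := by
    rw [Int.cast_eq_zero, jacobiSym.eq_zero_iff]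
    refine ⟨NeZero.ne D, fun h => hx ?_⟩
    rw [← ZMod.natCast_zmod_val x, ZMod.isUnit_iff_coprime]
    exact_mod_cast h

theorem jacobiChar_natCast (D : ℕ) [NeZero D] (n : ℕ) :
    jacobiChar D n = (jacobiSym n D : ℤ) := by
  change ((jacobiSym (n : ZMod D).val D : ℤ) : ℂ) = _
  rw [ZMod.val_natCast, Int.natCast_mod, ← jacobiSym.mod_left]

namespace ImaginaryQuadratic

variable {K : Type*} [Field K] [NumberField K] {D : ℕ} {α : K}

open ArithmeticFunction ArithmeticFunction.zeta in
theorem dedekindZeta_eq [NeZero D] (hK : Module.finrank ℚ K = 2) (hsf : Squarefree D)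
    (hD4 : D % 4 = 3) (hα : α ^ 2 = -(D : K)) {s : ℂ} (hs : 1 < s.re) :
    dedekindZeta K s = riemannZeta s * DirichletCharacter.LFunction (jacobiChar D) s := by
  set c : ℕ → ℂ := fun n => Nat.card {I : Ideal (𝓞 K) // Ideal.absNorm I = n} with hc
  set g : ArithmeticFunction ℂ := toArithmeticFunction (fun n : ℕ => jacobiChar D n) with hg
  have hgm : g.IsMultiplicative := DirichletCharacter.isMultiplicative_toArithmeticFunction _
  have hfm : (toArithmeticFunction c).IsMultiplicative := by
    rw [IsMultiplicative.iff_ne_zero]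
    constructor
    · simp only [toArithmeticFunction, coe_mk, hc]
      rw [if_neg one_ne_zero, Nat.cast_eq_one, Nat.card_eq_one_iff_unique]
      refine ⟨⟨fun x y => Subtype.ext ?_⟩, ⟨⟨⊤, by simp⟩⟩⟩
      rw [Ideal.absNorm_eq_one_iff.1 x.2, Ideal.absNorm_eq_one_iff.1 y.2]
    · intro m n hm hn hmn
      simp only [toArithmeticFunction, coe_mk, hc]
      rw [if_neg (mul_ne_zero hm hn), if_neg hm, if_neg hn, IdealCount.card_absNorm_mul hmn,
        Nat.cast_mul]
  have key : toArithmeticFunction c = (↑ζ : ArithmeticFunction ℂ) * g := by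
    rw [IsMultiplicative.eq_iff_eq_on_prime_powers _ hfm _ (isMultiplicative_zeta.natCast.mul hgm)]
    intro ℓ k hℓ
    rw [coe_zeta_mul_apply, Nat.sum_divisors_prime_pow hℓ]
    have h0 : ∀ j, ℓ ^ j ≠ 0 := fun j => pow_ne_zero _ hℓ.ne_zero
    have h1 : ∀ j, g (ℓ ^ j) = ((jacobiSym ℓ D ^ j : ℤ) : ℂ) := fun j => by
      simp only [toArithmeticFunction, coe_mk, hg]
      rw [if_neg (h0 j), Nat.cast_pow, map_pow, jacobiChar_natCast, Int.cast_pow]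
    simp only [h1]
    rw [← Int.cast_sum, ← card_absNorm_prime_pow hK hsf hD4 hα hℓ k]
    simp only [toArithmeticFunction, coe_mk, hc]
    rw [if_neg (h0 k), Int.cast_natCast]
  have hgs : LSeriesSummable (fun n => g n) s := by
    rw [LSeriesSummable_congr (g := fun n : ℕ => jacobiChar D n)]
    · exact DirichletCharacter.LSeriesSummable_of_one_lt_re _ hs
    · intro n hn
      simp [g, toArithmeticFunction, hn]
  have hζs : LSeriesSummable (fun n => (↑ζ : ArithmeticFunction ℂ) n) s := by
    simpa using LSeriesSummable_zeta_iff.2 hs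
  rw [DirichletCharacter.LFunction_eq_LSeries _ hs]
  have h2 : dedekindZeta K s = LSeries (fun n => ((↑ζ : ArithmeticFunction ℂ) * g) n) s := by
    rw [dedekindZeta, ← key]
    refine LSeries_congr (fun {n} hn => ?_) s
    simp [toArithmeticFunction, hn, hc]
  rw [h2, LSeries_mul' hζs hgs]
  congr 1
  · rw [← LSeries_zeta_eq_riemannZeta hs]; rfl
  · refine LSeries_congr (fun {n} hn => ?_) s
    simp [g, toArithmeticFunction, hn]

open Filter Topology in
theorem LFunction_one_eq [NeZero D] (hK : Module.finrank ℚ K = 2) (hsf : Squarefree D)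
    (hD4 : D % 4 = 3) (hD3 : 4 < D) (hα : α ^ 2 = -(D : K)) (hne : jacobiChar D ≠ 1) :
    DirichletCharacter.LFunction (jacobiChar D) 1 =
      ((Real.pi * classNumber K / Real.sqrt D : ℝ) : ℂ) := by
  rw [← residue_eq hK hsf hD4 hD3 hα]
  have h1 := tendsto_sub_one_mul_dedekindZeta_nhdsGT K
  have hcoe : Tendsto (fun s : ℝ => (s : ℂ)) (𝓝[>] 1) (𝓝[≠] 1) := by
    refine tendsto_nhdsWithin_iff.2 ⟨?_, ?_⟩
    · exact (Complex.continuous_ofReal.tendsto' 1 1 (by simp)).mono_left nhdsWithin_le_nhds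
    · filter_upwards [self_mem_nhdsWithin] with s hs
      simpa using (ne_of_gt hs)
  have h2 : Tendsto (fun s : ℝ => ((s : ℂ) - 1) * riemannZeta s) (𝓝[>] 1) (𝓝 1) :=
    riemannZeta_residue_one.comp hcoe
  have h3 : Tendsto (fun s : ℝ => DirichletCharacter.LFunction (jacobiChar D) (s : ℂ)) (𝓝[>] 1)
      (𝓝 (DirichletCharacter.LFunction (jacobiChar D) 1)) :=
    ((DirichletCharacter.differentiable_LFunction hne).continuous.tendsto 1).comp
      (hcoe.mono_right nhdsWithin_le_nhds)
  have h4 := h2.mul h3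
  rw [one_mul] at h4
  refine tendsto_nhds_unique h4 (h1.congr' ?_)
  filter_upwards [self_mem_nhdsWithin] with s hs
  rw [dedekindZeta_eq hK hsf hD4 hα (by simpa using hs)]
  ring

end ImaginaryQuadratic

end

section

open HurwitzZeta Filter Topology

theorem abs_rpow_neg_sub_rpow_neg_le {x y m s k : ℝ} (hm : 0 < m) (hm1 : m ≤ 1) (hk : 1 ≤ k)
    (hx : k * m ≤ x) (hxy : x ≤ y) (hyx : y ≤ x + 1) (hs : 1 ≤ s) (hs2 : s ≤ 2) :
    |1 / x ^ s - 1 / y ^ s| ≤ 2 * m⁻¹ ^ 3 * (1 / k ^ 2) := by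
  have hkm : 0 < k * m := by positivity
  have hx0 : 0 < x := hkm.trans_le hx
  have hy0 : 0 < y := hx0.trans_le hxy
  have h1 : 1 / y ^ s ≤ 1 / x ^ s :=
    one_div_le_one_div_of_le (by positivity) (Real.rpow_le_rpow hx0.le hxy (by linarith))
  rw [abs_of_nonneg (by linarith)]
  have h2 : 1 + s * (x / y - 1) ≤ (x / y) ^ s := by
    have := one_add_mul_self_le_rpow_one_add (s := x / y - 1) (p := s)
      (by have : 0 < x / y := by positivity
          linarith) hs
    simpa using this
  have h3 : 1 / x ^ s - 1 / y ^ s = 1 / x ^ s * (1 - (x / y) ^ s) := by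
    rw [Real.div_rpow hx0.le hy0.le]
    have : x ^ s ≠ 0 := by positivity
    field_simp
  have h4 : 1 - (x / y) ^ s ≤ 2 * (1 / x) := by
    have h5 : 1 - x / y ≤ 1 / x := by
      rw [sub_le_iff_le_add, ← sub_le_iff_le_add', ]
      have : 1 - 1 / x ≤ x / y := by
        rw [le_div_iff₀ hy0, sub_mul, one_mul]
        have : 1 ≤ 1 / x * y := by rw [one_div, inv_mul_eq_div, le_div_iff₀ hx0]; linarith
        linarith
      linarith
    have h6 : 0 ≤ 1 - x / y := by rw [sub_nonneg, div_le_one hy0]; exact hxy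
    nlinarith
  have h7 : 1 / x ^ s ≤ 1 / (k * m) ^ s :=
    one_div_le_one_div_of_le (by positivity) (Real.rpow_le_rpow hkm.le hx (by linarith))
  have h8 : 1 / x ≤ 1 / (k * m) := one_div_le_one_div_of_le (by positivity) hx
  have h9 : 1 / (k * m) ^ s ≤ 1 / k * (1 / m ^ 2) := by
    rw [Real.mul_rpow (by linarith) hm.le, one_div, mul_inv, ← one_div, ← one_div]
    gcongr
    · exact Real.self_le_rpow_of_one_le hk hs
    · rw [← Real.rpow_natCast]
      exact Real.rpow_le_rpow_of_exponent_ge hm hm1 (by simpa using hs2)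
  rw [h3]
  calc 1 / x ^ s * (1 - (x / y) ^ s) ≤ 1 / x ^ s * (2 * (1 / x)) := by gcongr
    _ ≤ (1 / k * (1 / m ^ 2)) * (2 * (1 / (k * m))) := by
        gcongr; exact h7.trans h9
    _ = 2 * m⁻¹ ^ 3 * (1 / k ^ 2) := by field_simp

theorem abs_term_le {a m s : ℝ} (hm : 0 < m) (hma : m ≤ a) (hma' : m ≤ 1 - a)
    (hs : 1 ≤ s) (hs2 : s ≤ 2) (n : ℕ) :
    |1 / (n + a) ^ s - 1 / (n + 1 - a) ^ s| ≤ 2 * m⁻¹ ^ 3 * (1 / ((n + 1 : ℕ) : ℝ) ^ 2) := by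
  have hn : (0 : ℝ) ≤ n := n.cast_nonneg
  have hm1 : m ≤ 1 := by linarith
  have hk : (1 : ℝ) ≤ ((n + 1 : ℕ) : ℝ) := by push_cast; linarith
  rcases le_total (n + a) (n + 1 - a) with h | h
  · exact abs_rpow_neg_sub_rpow_neg_le hm hm1 hk (by push_cast; nlinarith) h (by linarith) hs hs2
  · rw [abs_sub_comm]
    exact abs_rpow_neg_sub_rpow_neg_le hm hm1 hk (by push_cast; nlinarith) h (by linarith) hs hs2

theorem hurwitzZetaOdd_one_eq_tsum {a : ℝ} (ha0 : 0 < a) (ha1 : a < 1) :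
    Summable (fun n : ℕ => 1 / (n + a) - 1 / (n + 1 - a)) ∧
      hurwitzZetaOdd a 1 = ((∑' n : ℕ, (1 / (n + a) - 1 / (n + 1 - a)) / 2 : ℝ) : ℂ) := by
  obtain ⟨m, hm, hma, hma'⟩ : ∃ m, 0 < m ∧ m ≤ a ∧ m ≤ 1 - a :=
    ⟨min a (1 - a), lt_min ha0 (by linarith), min_le_left _ _, min_le_right _ _⟩
  have hsum : Summable fun n : ℕ => 2 * m⁻¹ ^ 3 * (1 / ((n + 1 : ℕ) : ℝ) ^ 2) :=
    (((summable_nat_add_iff 1).2 (Real.summable_one_div_nat_pow.2 one_lt_two)).mul_left _)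
  constructor
  · refine Summable.of_norm_bounded hsum fun n => ?_
    simpa using abs_term_le hm hma hma' le_rfl one_le_two n
  have h1 : Tendsto (fun s : ℝ => ∑' n : ℕ, (1 / (n + a) ^ s - 1 / (n + 1 - a) ^ s) / 2) (𝓝[>] 1)
      (𝓝 (∑' n : ℕ, (1 / (n + a) ^ (1 : ℝ) - 1 / (n + 1 - a) ^ (1 : ℝ)) / 2)) := by
    refine tendsto_tsum_of_dominated_convergence hsum (fun n => ?_) ?_
    · have hn : (0 : ℝ) ≤ n := n.cast_nonneg
      have : ContinuousAt (fun s : ℝ => (1 / (n + a) ^ s - 1 / (n + 1 - a) ^ s) / 2) 1 := by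
        have h1 : (n + a) ≠ 0 := by linarith
        have h2 : (n + 1 - a) ≠ 0 := by linarith
        have := (Real.continuous_const_rpow h1).continuousAt (x := 1)
        have := (Real.continuous_const_rpow h2).continuousAt (x := 1)
        have h3 : (n + a) ^ (1 : ℝ) ≠ 0 := by simpa using h1
        have h4 : (n + 1 - a) ^ (1 : ℝ) ≠ 0 := by simpa using h2
        fun_prop (disch := assumption)
      exact this.tendsto.mono_left nhdsWithin_le_nhds
    · have : Set.Ioc (1 : ℝ) 2 ∈ 𝓝[>] (1 : ℝ) := Ioc_mem_nhdsGT one_lt_two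
      filter_upwards [this] with s hs n
      rw [norm_div, Real.norm_eq_abs, Real.norm_two]
      have := abs_term_le hm hma hma' hs.1.le hs.2 n
      exact (half_le_self (abs_nonneg _)).trans this
  have h2 : Tendsto (fun s : ℝ => hurwitzZetaOdd a (s : ℂ)) (𝓝[>] 1) (𝓝 (hurwitzZetaOdd a 1)) :=
    ((differentiable_hurwitzZetaOdd a).continuous.comp Complex.continuous_ofReal).tendsto' 1 _
      (by simp) |>.mono_left nhdsWithin_le_nhds
  simp only [Real.rpow_one] at h1
  refine tendsto_nhds_unique h2 (((Complex.continuous_ofReal.tendsto _).comp h1).congr' ?_)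
  filter_upwards [self_mem_nhdsWithin] with s hs
  rw [Function.comp_apply, Complex.ofReal_tsum,
    ← (hasSum_nat_hurwitzZetaOdd_of_mem_Icc ⟨ha0.le, ha1.le⟩ (s := s) (by simpa using hs)).tsum_eq]
  congr 1
  ext n
  have hn : (0 : ℝ) ≤ n := n.cast_nonneg
  push_cast
  rw [Complex.ofReal_cpow (by linarith), Complex.ofReal_cpow (by linarith)]
  push_cast
  rfl

theorem hurwitzZetaOdd_one {a : ℝ} (ha0 : 0 < a) (ha1 : a < 1) :
    hurwitzZetaOdd a 1 = Real.pi / 2 * Complex.cot (Real.pi * a) := by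
  obtain ⟨hs, h⟩ := hurwitzZetaOdd_one_eq_tsum ha0 ha1
  have haZ : (a : ℂ) ∈ Complex.integerComplement := by
    rintro ⟨k, hk⟩
    have : (k : ℝ) = a := by exact_mod_cast hk
    rw [← this] at ha0 ha1
    have h1 : 0 < k := by exact_mod_cast ha0
    have h2 : k < 1 := by exact_mod_cast ha1
    omega
  have hcot := (Summable.hasSum_iff_tendsto_nat (summable_cotTerm haZ)).1 (summable_cotTerm haZ).hasSum
  have hc2 : ∑' n, cotTerm (a : ℂ) n = Real.pi * Complex.cot (Real.pi * a) - 1 / a :=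
    (cot_series_rep' haZ).symm
  rw [hc2] at hcot
  have hs' : Tendsto (fun N : ℕ => ((∑ n ∈ Finset.range N, (1 / (n + a) - 1 / (n + 1 - a)) : ℝ) : ℂ)) atTop
      (𝓝 ((∑' n : ℕ, (1 / (n + a) - 1 / (n + 1 - a)) : ℝ) : ℂ)) :=
    (Complex.continuous_ofReal.tendsto _).comp hs.hasSum.tendsto_sum_nat
  have hz : Tendsto (fun N : ℕ => 1 / ((N : ℂ) + a)) atTop (𝓝 0) := by
    have : Tendsto (fun N : ℕ => 1 / ((N : ℝ) + a)) atTop (𝓝 0) := by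
      simp only [one_div]
      exact (tendsto_natCast_atTop_atTop.atTop_add (tendsto_const_nhds (x := a))).inv_tendsto_atTop
    simpa [Function.comp_def] using (Complex.continuous_ofReal.tendsto _).comp this
  have key : ∀ N : ℕ, ((∑ n ∈ Finset.range N, (1 / (n + a) - 1 / (n + 1 - a)) : ℝ) : ℂ) =
      ∑ n ∈ Finset.range N, cotTerm (a : ℂ) n + 1 / a - 1 / ((N : ℂ) + a) := by
    intro N
    induction N with
    | zero => simp
    | succ N ih =>
      rw [Finset.sum_range_succ, Finset.sum_range_succ, Complex.ofReal_add, ih, cotTerm]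
      push_cast
      have : (1 : ℂ) / (a - (N + 1)) = - (1 / (N + 1 - a)) := by
        rw [← neg_sub, div_neg]
      rw [this]
      ring
  have h3 := tendsto_nhds_unique hs' (((hcot.add_const (1 / (a : ℂ))).sub hz).congr fun N => (key N).symm)
  rw [h, tsum_div_const, Complex.ofReal_div, h3]
  push_cast
  ring

end

section

open HurwitzZeta

theorem sum_range_mul_pow {R : Type*} [CommRing R] (z : R) (M : ℕ) :
    (z - 1) * ∑ k ∈ Finset.range M, (k : R) * z ^ k =
      M * z ^ M - ∑ k ∈ Finset.range M, z ^ (k + 1) := by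
  induction M with
  | zero => simp
  | succ M ih =>
    rw [Finset.sum_range_succ, Finset.sum_range_succ, mul_add, ih]
    push_cast; ring

theorem ZMod.sum_val_eq_sum_range {M : Type*} [AddCommMonoid M] (N : ℕ) [NeZero N] (f : ℕ → M) :
    ∑ k : ZMod N, f k.val = ∑ k ∈ Finset.range N, f k := by
  obtain ⟨n, rfl⟩ := Nat.exists_eq_succ_of_ne_zero (NeZero.ne N)
  exact Fin.sum_univ_eq_sum_range f (n + 1)

namespace DirichletCharacter

variable {N : ℕ} [NeZero N]

theorem gaussSum_mul_gaussSum_inv {χ : DirichletCharacter ℂ N} (hχ : χ.IsPrimitive) :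
    gaussSum χ ZMod.stdAddChar * gaussSum χ⁻¹ (ZMod.stdAddChar)⁻¹ = N := by
  have h1 : gaussSum χ ZMod.stdAddChar * gaussSum χ⁻¹ (ZMod.stdAddChar)⁻¹ =
      ∑ a : ZMod N, ∑ x : ZMod N, χ x * ZMod.stdAddChar (a * (x - 1)) := by
    rw [gaussSum, gaussSum, mul_comm, Finset.sum_mul]
    refine Finset.sum_congr rfl fun a _ => ?_
    have := gaussSum_mulShift_of_isPrimitive ZMod.stdAddChar hχ a
    rw [mul_right_comm, ← gaussSum, ← this, gaussSum, Finset.sum_mul]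
    refine Finset.sum_congr rfl fun x _ => ?_
    rw [AddChar.inv_apply, AddChar.mulShift_apply, mul_assoc, ← AddChar.map_add_eq_mul]
    ring_nf
  rw [h1, Finset.sum_comm]
  simp_rw [← Finset.mul_sum]
  have h2 : ∀ x : ZMod N, ∑ a : ZMod N, ZMod.stdAddChar (a * (x - 1)) = if x = 1 then (N : ℂ) else 0 := by
    intro x
    rw [AddChar.sum_mulShift _ (ZMod.isPrimitive_stdAddChar N), ZMod.card]
    simp [sub_eq_zero]
  simp_rw [h2]
  simp

theorem gaussSum_sq_of_odd {χ : DirichletCharacter ℂ N} (hχ : χ.IsPrimitive) (hodd : χ.Odd)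
    (hinv : χ⁻¹ = χ) : gaussSum χ ZMod.stdAddChar ^ 2 = -N := by
  have h1 := gaussSum_mul_gaussSum_inv hχ
  have h2 : gaussSum χ (ZMod.stdAddChar)⁻¹ = - gaussSum χ ZMod.stdAddChar := by
    have := gaussSum_mulShift_of_isPrimitive ZMod.stdAddChar hχ (-1)
    rw [hinv, hodd, neg_one_mul] at this
    rw [← this, AddChar.inv_mulShift]
  rw [hinv, h2] at h1
  linear_combination -h1

theorem cot_eq (j : ZMod N) (hj : j ≠ 0) :
    Complex.cot (Real.pi * ((j.val / N : ℝ) : ℂ)) =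
      Complex.I * (1 + 2 / N * ∑ k : ZMod N, (k.val : ℂ) * ZMod.stdAddChar (j * k)) := by
  have hN : (N : ℂ) ≠ 0 := by exact_mod_cast NeZero.ne N
  set z : ℂ := ZMod.stdAddChar j with hz
  have hz1 : z ≠ 1 := by
    rw [hz, ← AddChar.map_zero_eq_one (ZMod.stdAddChar (N := N))]
    exact fun h => hj (ZMod.injective_stdAddChar h)
  have hzN : z ^ N = 1 := by
    rw [hz, ← AddChar.map_nsmul_eq_pow]; simp
  have hzexp : z = Complex.exp (2 * Complex.I * (Real.pi * ((j.val / N : ℝ) : ℂ))) := by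
    have := ZMod.stdAddChar_coe (N := N) (j.val : ℤ)
    rw [Int.cast_natCast, ZMod.natCast_zmod_val] at this
    rw [hz, this]; push_cast; congr 1; ring
  have hsum : ∑ k : ZMod N, (k.val : ℂ) * ZMod.stdAddChar (j * k) = N / (z - 1) := by
    have h1 : ∀ k : ZMod N, (k.val : ℂ) * ZMod.stdAddChar (j * k) = (k.val : ℂ) * z ^ k.val := by
      intro k
      rw [hz, ← AddChar.map_nsmul_eq_pow, nsmul_eq_mul, ZMod.natCast_zmod_val, mul_comm k]
    simp_rw [h1]
    rw [ZMod.sum_val_eq_sum_range N (fun k => (k : ℂ) * z ^ k), eq_div_iff (sub_ne_zero.2 hz1),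
      mul_comm, sum_range_mul_pow z, hzN]
    have : ∑ k ∈ Finset.range N, z ^ (k + 1) = 0 := by
      simp_rw [pow_succ]
      rw [← Finset.sum_mul, geom_sum_eq hz1, hzN]; simp
    rw [this]; ring
  rw [hsum, Complex.cot_eq_exp_ratio, ← hzexp]
  have hz1' := sub_ne_zero.2 hz1
  have hI : Complex.I ≠ 0 := Complex.I_ne_zero
  have h3 : Complex.I * (1 - z) ≠ 0 := mul_ne_zero hI (by rwa [← neg_sub, neg_ne_zero])
  rw [div_eq_iff h3]
  field_simp
  rw [Complex.I_sq]
  ring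

theorem LFunction_one_of_odd {χ : DirichletCharacter ℂ N} (hχ : χ.IsPrimitive) (hodd : χ.Odd) :
    LFunction χ 1 = Real.pi * Complex.I / N ^ 2 * gaussSum χ ZMod.stdAddChar *
      ∑ k : ZMod N, χ⁻¹ k * k.val := by
  have hN : (N : ℂ) ≠ 0 := by exact_mod_cast NeZero.ne N
  have hne : χ ≠ 1 := by
    rintro rfl
    have := hodd
    rw [DirichletCharacter.Odd, MulChar.one_apply isUnit_one.neg] at this
    norm_num at this
  have hN1 : N ≠ 1 := by
    rintro rfl
    exact hne (level_one χ)
  have h0 : ∑ j : ZMod N, χ j = 0 := MulChar.sum_eq_zero_of_ne_one hne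
  rw [LFunction, ZMod.LFunction_def_odd hodd.to_fun]
  have h1 : ∀ j : ZMod N, χ j * hurwitzZetaOdd (ZMod.toAddCircle j) 1 =
      χ j * (Real.pi / 2 * (Complex.I * (1 + 2 / N * ∑ k : ZMod N, (k.val : ℂ) * ZMod.stdAddChar (j * k)))) := by
    intro j
    by_cases hj : j = 0
    · rw [hj, DirichletCharacter.map_zero' _ hN1, zero_mul, zero_mul]
    · have hj0 : 0 < j.val := Nat.pos_of_ne_zero ((ZMod.val_ne_zero j).2 hj)
      have hNpos : 0 < (N : ℝ) := by exact_mod_cast NeZero.pos N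
      rw [ZMod.toAddCircle_apply, hurwitzZetaOdd_one (by positivity)
        ((div_lt_one hNpos).2 (by exact_mod_cast ZMod.val_lt j)), cot_eq j hj]
  simp_rw [h1]
  have h2 : ∀ k : ZMod N, ∑ j : ZMod N, χ j * ZMod.stdAddChar (j * k) =
      χ⁻¹ k * gaussSum χ ZMod.stdAddChar := by
    intro k
    rw [← gaussSum_mulShift_of_isPrimitive ZMod.stdAddChar hχ k, gaussSum]
    simp_rw [AddChar.mulShift_apply, mul_comm k]
  have h3 : ∑ j : ZMod N, χ j * ∑ k : ZMod N, (k.val : ℂ) * ZMod.stdAddChar (j * k) =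
      gaussSum χ ZMod.stdAddChar * ∑ k : ZMod N, χ⁻¹ k * k.val := by
    simp_rw [Finset.mul_sum]
    rw [Finset.sum_comm]
    refine Finset.sum_congr rfl fun k _ => ?_
    rw [← mul_assoc, mul_comm (gaussSum _ _), ← h2, Finset.sum_mul]
    refine Finset.sum_congr rfl fun j _ => ?_
    ring
  have h4 : ∑ j : ZMod N, χ j * (Real.pi / 2 * (Complex.I * (1 + 2 / N * ∑ k : ZMod N, (k.val : ℂ) * ZMod.stdAddChar (j * k)))) =
      Real.pi / 2 * Complex.I * ∑ j : ZMod N, χ j + Real.pi * Complex.I / N *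
      ∑ j : ZMod N, χ j * ∑ k : ZMod N, (k.val : ℂ) * ZMod.stdAddChar (j * k) := by
    rw [Finset.mul_sum, Finset.mul_sum, ← Finset.sum_add_distrib]
    refine Finset.sum_congr rfl fun j _ => ?_
    ring
  rw [h4, h0, h3, Complex.cpow_neg_one]
  field_simp
  ring

end DirichletCharacter

end

section

open DirichletCharacter

theorem jacobiChar_intCast (D : ℕ) [NeZero D] (a : ℤ) :
    jacobiChar D a = (jacobiSym a D : ℤ) := by
  have h1 : ((a : ZMod D).val : ℤ) = a % D := ZMod.val_intCast a
  change ((jacobiSym (a : ZMod D).val D : ℤ) : ℂ) = _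
  rw [h1, ← jacobiSym.mod_left]

theorem jacobiChar_inv (D : ℕ) [NeZero D] : (jacobiChar D)⁻¹ = jacobiChar D := by
  rw [inv_eq_iff_mul_eq_one]
  ext u
  rw [MulChar.mul_apply, MulChar.one_apply_coe]
  change ((jacobiSym (u : ZMod D).val D : ℤ) : ℂ) * ((jacobiSym (u : ZMod D).val D : ℤ) : ℂ) = 1
  have hc : Int.gcd ((u : ZMod D).val : ℤ) D = 1 := by
    rw [Int.gcd_natCast_natCast]; exact ZMod.val_coe_unit_coprime u
  rcases jacobiSym.eq_one_or_neg_one hc with h | h <;> rw [h] <;> norm_num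

theorem jacobiChar_odd {D : ℕ} [NeZero D] (hD4 : D % 4 = 3) : (jacobiChar D).Odd := by
  have := jacobiChar_intCast D (-1)
  rw [jacobiSym.at_neg_one (Nat.odd_iff.2 (by omega)), ZMod.χ₄_nat_three_mod_four hD4] at this
  simpa [DirichletCharacter.Odd] using this

theorem exists_jacobiSym_eq_neg_one {p r : ℕ} (hp : p.Prime) (hp2 : p ≠ 2) (hr : r.Prime)
    (hpr : p ≠ r) : ∃ n : ℕ, n ≡ 1 [MOD r] ∧ jacobiSym n (p * r) = -1 := by
  have : Fact p.Prime := ⟨hp⟩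
  obtain ⟨a, ha⟩ := quadraticChar_exists_neg_one (F := ZMod p) (by rwa [ZMod.ringChar_zmod_n])
  obtain ⟨n, hn1, hn2⟩ := Nat.chineseRemainder ((Nat.coprime_primes hp hr).2 hpr) a.val 1
  refine ⟨n, hn2, ?_⟩
  rw [jacobiSym.mul_right' _ hp.ne_zero hr.ne_zero, ← jacobiSym.legendreSym.to_jacobiSym]
  have h1 : jacobiSym n r = 1 := by
    rw [jacobiSym.mod_left, ← Int.natCast_mod, hn2, Int.natCast_mod, ← jacobiSym.mod_left, Nat.cast_one,
      jacobiSym.one_left]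
  rw [h1, mul_one, legendreSym, Int.cast_natCast, (ZMod.natCast_eq_natCast_iff _ _ _).2 hn1,
    ZMod.natCast_zmod_val, ha]

theorem not_factorsThrough_jacobiChar {D p r : ℕ} [NeZero D] (hD : D = p * r) (hp : p.Prime)
    (hp2 : p ≠ 2) (hr : r.Prime) (hpr : p ≠ r) : ¬ (jacobiChar D).FactorsThrough r := by
  subst hD
  intro h
  rw [factorsThrough_iff_ker_unitsMap (Dvd.intro_left _ rfl)] at h
  obtain ⟨n, hn, hj⟩ := exists_jacobiSym_eq_neg_one hp hp2 hr hpr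
  have hc : n.Coprime (p * r) := by
    by_contra hc
    have : jacobiSym n (p * r) = 0 := by
      rw [jacobiSym.eq_zero_iff]
      exact ⟨NeZero.ne _, by rwa [Int.gcd_natCast_natCast]⟩
    omega
  have h1 := h (x := ZMod.unitOfCoprime n hc) (by
    rw [MonoidHom.mem_ker]
    ext
    rw [ZMod.unitsMap_val, ZMod.coe_unitOfCoprime, ZMod.cast_natCast (Dvd.intro_left _ rfl)]
    simpa using (ZMod.natCast_eq_natCast_iff _ _ _).2 hn)
  rw [MonoidHom.mem_ker] at h1
  have h2 := congrArg Units.val h1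
  rw [MulChar.coe_toUnitHom, ZMod.coe_unitOfCoprime, jacobiChar_natCast, hj] at h2
  norm_num at h2

theorem jacobiChar_isPrimitive {D p r : ℕ} [NeZero D] (hD : D = p * r) (hp : p.Prime)
    (hp2 : p ≠ 2) (hr : r.Prime) (hr2 : r ≠ 2) (hpr : p ≠ r) : (jacobiChar D).IsPrimitive := by
  have hd := conductor_dvd_level (jacobiChar D)
  have hf := factorsThrough_conductor (jacobiChar D)
  rw [isPrimitive_def]
  set c := conductor (jacobiChar D)
  have hr' : ¬ c ∣ r := fun h => not_factorsThrough_jacobiChar hD hp hp2 hr hpr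
    (hf.mono _ h (hD ▸ Dvd.intro_left _ rfl))
  have hp' : ¬ c ∣ p := fun h => not_factorsThrough_jacobiChar (hD.trans (mul_comm p r)) hr hr2 hp
    hpr.symm (hf.mono _ h (hD ▸ Dvd.intro _ rfl))
  rw [hD] at hd ⊢
  have hpc : p ∣ c := by
    by_contra h
    exact hr' (((Nat.Prime.coprime_iff_not_dvd hp).2 h).symm.dvd_of_dvd_mul_left hd)
  have hrc : r ∣ c := by
    by_contra h
    exact hp' (((Nat.Prime.coprime_iff_not_dvd hr).2 h).symm.dvd_of_dvd_mul_right hd)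
  exact Nat.dvd_antisymm hd (((Nat.coprime_primes hp hr).2 hpr).mul_dvd_of_dvd_of_dvd hpc hrc)

open NumberField in
theorem classNumber_mul_eq {K : Type*} [Field K] [NumberField K] {D p r : ℕ} (hD : D = p * r)
    (hp : p.Prime) (hr : r.Prime) (hpr : p ≠ r) (hD4 : D % 4 = 3) (hK : Module.finrank ℚ K = 2)
    {α : K} (hα : α ^ 2 = -(D : K)) :
    (classNumber K * D : ℤ) = |∑ k ∈ Finset.range D, jacobiSym k D * k| := by
  have hodd : ∀ {a b : ℕ}, a * b % 4 = 3 → a ≠ 2 := by rintro _ b h rfl; omega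
  have hp2 := hodd (hD ▸ hD4)
  have hr2 : r ≠ 2 := hodd (mul_comm p r ▸ hD ▸ hD4)
  have hsf : Squarefree D := hD ▸
    (Nat.squarefree_mul ((Nat.coprime_primes hp hr).2 hpr)).2 ⟨hp.squarefree, hr.squarefree⟩
  have : NeZero D := ⟨hsf.ne_zero⟩
  have hlt : 4 < D := by
    have h1 := hp.two_le; have h2 := hr.two_le
    have : 3 ≤ p := by omega
    nlinarith
  have hprim := jacobiChar_isPrimitive hD hp hp2 hr hr2 hpr
  have hO := jacobiChar_odd hD4
  have hne : jacobiChar D ≠ 1 := by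
    intro h
    rw [h, DirichletCharacter.Odd, MulChar.one_apply isUnit_one.neg] at hO
    norm_num at hO
  have h1 := ImaginaryQuadratic.LFunction_one_eq hK hsf hD4 hlt hα hne
  rw [LFunction_one_of_odd hprim hO, jacobiChar_inv] at h1
  set S : ℤ := ∑ k ∈ Finset.range D, jacobiSym k D * k with hS
  have h2 : ∑ k : ZMod D, jacobiChar D k * k.val = (S : ℂ) := by
    rw [hS, Int.cast_sum, ← ZMod.sum_val_eq_sum_range D (fun k => ((jacobiSym k D * k : ℤ) : ℂ))]
    refine Finset.sum_congr rfl fun k _ => ?_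
    rw [Int.cast_mul, ← jacobiChar_natCast, ZMod.natCast_zmod_val, Int.cast_natCast]
  have h3 := gaussSum_sq_of_odd hprim hO (jacobiChar_inv D)
  rw [h2] at h1
  have hDpos : (0 : ℝ) < D := by exact_mod_cast NeZero.pos D
  have hD0 : (D : ℂ) ≠ 0 := by exact_mod_cast NeZero.ne D
  have hpi : (Real.pi : ℂ) ≠ 0 := by exact_mod_cast Real.pi_ne_zero
  have h4 : ((Real.sqrt D : ℝ) : ℂ) ^ 2 = D := by
    rw [← Complex.ofReal_pow, Real.sq_sqrt hDpos.le, Complex.ofReal_natCast]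
  have h5 : ((classNumber K : ℂ) * D) ^ 2 = (S : ℂ) ^ 2 := by
    have h6 := congrArg (· ^ 2) h1
    simp only [mul_pow, div_pow, Complex.ofReal_div, Complex.ofReal_mul, h3, h4, Complex.I_sq,
      Complex.ofReal_natCast] at h6
    field_simp at h6
    linear_combination -h6
  have h6 : ((classNumber K : ℤ) * D) ^ 2 = S ^ 2 := by exact_mod_cast h5
  rw [← (sq_eq_sq_iff_abs_eq_abs _ _).1 h6, abs_of_nonneg (by positivity)]

end

namespace ValuationSubring

theorem exists_valuation_natCast_lt_one (K : Type*) [Field K] [CharZero K] {ℓ : ℕ}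
    (hℓ : ℓ.Prime) : ∃ A : ValuationSubring K, A.valuation ℓ < 1 := by
  let R : Subring K := (Int.castRingHom K).range
  let x : R := ⟨ℓ, (ℓ : ℤ), by simp⟩
  have hI : Ideal.span {x} ≠ ⊤ := by
    rw [Ne, Ideal.span_singleton_eq_top]
    intro hx
    obtain ⟨⟨_, n, rfl⟩, hy⟩ := hx.exists_right_inv
    have h1 : (ℓ : K) * (n : K) = 1 := congrArg Subtype.val hy
    have h2 : (ℓ : ℤ) * n = 1 := by exact_mod_cast h1
    exact hℓ.one_lt.ne' (by simpa using Int.natAbs_dvd_natAbs.2 (Dvd.intro _ h2))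
  obtain ⟨A, -, hA⟩ := Ideal.image_subset_nonunits_valuationSubring _ hI
  exact ⟨A, hA ⟨x, Ideal.mem_span_singleton_self x, rfl⟩⟩

variable {K : Type*} [Field K] {A : ValuationSubring K}

theorem valuation_le_one_of_isIntegral {x : K} (hx : IsIntegral ℤ x) : A.valuation x ≤ 1 :=
  (A.valuation.mem_integer_iff x).1 <|
    (Valuation.integer.integers A.valuation).mem_of_integral <| hx.tower_top

theorem valuation_intCast_le_one (n : ℤ) : A.valuation n ≤ 1 :=
  valuation_le_one_of_isIntegral (isIntegral_algebraMap (R := ℤ) (x := n))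

theorem valuation_intCast_lt_one_iff {ℓ : ℕ} (hℓ : ℓ.Prime) (hA : A.valuation ℓ < 1) {n : ℤ} :
    A.valuation n < 1 ↔ (ℓ : ℤ) ∣ n := by
  refine ⟨fun h => ?_, ?_⟩
  · by_contra hn
    obtain ⟨a, b, hab⟩ := (Int.isCoprime_iff_gcd_eq_one.2
      ((Nat.Prime.coprime_iff_not_dvd hℓ).2 fun h => hn (Int.natCast_dvd.2 h)) :
        IsCoprime (ℓ : ℤ) n)
    have h1 : A.valuation ((a * ℓ + b * n : ℤ) : K) < 1 := by
      push_cast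
      refine A.valuation.map_add_lt ?_ ?_ <;> rw [map_mul]
      · exact (mul_le_of_le_one_left' (valuation_intCast_le_one _)).trans_lt hA
      · exact (mul_le_of_le_one_left' (valuation_intCast_le_one _)).trans_lt h
    rw [hab] at h1
    simp at h1
  · rintro ⟨m, rfl⟩
    push_cast
    rw [map_mul]
    exact (mul_le_of_le_one_right' (valuation_intCast_le_one _)).trans_lt hA

theorem valuation_intCast_eq_one {ℓ : ℕ} (hℓ : ℓ.Prime) (hA : A.valuation ℓ < 1) {n : ℤ}
    (hn : ¬ (ℓ : ℤ) ∣ n) : A.valuation n = 1 :=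
  le_antisymm (valuation_intCast_le_one n)
    (not_lt.1 fun h => hn ((valuation_intCast_lt_one_iff hℓ hA).1 h))

theorem valuation_eq_one_of_pow_eq_one {x : K} {n : ℕ} (hn : n ≠ 0) (hx : x ^ n = 1) :
    A.valuation x = 1 := by
  have h := congrArg A.valuation hx
  rw [map_pow, map_one] at h
  exact (pow_eq_one_iff.1 h).resolve_right hn

theorem charP_residueField {ℓ : ℕ} (hℓ : ℓ.Prime) (hA : A.valuation ℓ < 1) :
    CharP (IsLocalRing.ResidueField A) ℓ := by
  have : Fact ℓ.Prime := ⟨hℓ⟩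
  refine (CharP.charP_iff_prime_eq_zero hℓ).2 ?_
  rw [← map_natCast (IsLocalRing.residue A), IsLocalRing.residue_eq_zero_iff,
    A.valuation_lt_one_iff]
  simpa using hA

theorem residue_eq_residue_iff {x y : A} :
    IsLocalRing.residue A x = IsLocalRing.residue A y ↔ A.valuation ((x : K) - y) < 1 := by
  rw [← sub_eq_zero, ← map_sub, IsLocalRing.residue_eq_zero_iff, A.valuation_lt_one_iff]
  rfl

theorem valuation_sub_one_lt_one {ℓ : ℕ} (hℓ : ℓ.Prime) (hA : A.valuation ℓ < 1) {x : K} {k : ℕ}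
    (hx : x ^ ℓ ^ k = 1) : A.valuation (x - 1) < 1 := by
  have := charP_residueField hℓ hA
  have : Fact ℓ.Prime := ⟨hℓ⟩
  have hm : x ∈ A := (A.valuation_le_one_iff x).1
    (valuation_eq_one_of_pow_eq_one (pow_ne_zero k hℓ.ne_zero) hx).le
  have h1 : (⟨x, hm⟩ : A) ^ ℓ ^ k = 1 := Subtype.ext hx
  have h2 := congrArg (IsLocalRing.residue A) h1
  rw [map_pow, map_one] at h2
  have h3 : (IsLocalRing.residue A ⟨x, hm⟩ - 1) ^ ℓ ^ k = 0 := by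
    rw [sub_pow_char_pow, h2, one_pow, sub_self]
  have h4 := sub_eq_zero.1 (pow_eq_zero_iff (pow_ne_zero k hℓ.ne_zero) |>.1 h3)
  rw [← map_one (IsLocalRing.residue A)] at h4
  simpa using residue_eq_residue_iff.1 h4

theorem valuation_sum_lt_one {ι : Type*} {s : Finset ι} {f : ι → K}
    (hf : ∀ i ∈ s, A.valuation (f i) < 1) : A.valuation (∑ i ∈ s, f i) < 1 :=
  Valuation.map_sum_lt _ one_ne_zero hf

end ValuationSubring

section

open Polynomial IsLocalRing

namespace ValuationSubring

variable {K : Type*} [Field K] {A : ValuationSubring K}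

theorem X_pow_sub_one_residueField_eq_prod {n : ℕ} (hn : 0 < n) {z : K} (hz : IsPrimitiveRoot z n) :
    (X ^ n - 1 : (ResidueField A)[X]) =
      ∏ x ∈ nthRootsFinset n (1 : A), (X - C (residue A x)) := by
  have hm : z ∈ A := (A.valuation_le_one_iff z).1
    (valuation_eq_one_of_pow_eq_one hn.ne' hz.pow_eq_one).le
  have h1 : IsPrimitiveRoot (⟨z, hm⟩ : A) n :=
    IsPrimitiveRoot.of_map_of_injective (f := A.subtype) hz Subtype.val_injective
  have h2 := congrArg (Polynomial.map (residue A)) (X_pow_sub_one_eq_prod hn h1)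
  simpa [Polynomial.map_prod] using h2

theorem exists_teichmuller {p : ℕ} [Fact p.Prime] {F : Type*} [Field F] [Fintype F]
    [Algebra (ZMod p) F] [CharP (ResidueField A) p] {z : K}
    (hz : IsPrimitiveRoot z (Fintype.card F - 1)) :
    ∃ (ω : MulChar F K) (ι : F →+* ResidueField A),
      ∀ x, ∃ hx : ω x ∈ A, residue A ⟨ω x, hx⟩ = ι x := by
  classical
  let _ : Algebra (ZMod p) (ResidueField A) := ZMod.algebra _ p
  have hq : 0 < Fintype.card F - 1 := Nat.sub_pos_of_lt Fintype.one_lt_card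
  have hprod := X_pow_sub_one_residueField_eq_prod (A := A) hq hz
  have : IsSplittingField (ZMod p) F (X ^ Fintype.card F - X) :=
    FiniteField.isSplittingField_sub F (ZMod p)
  let ι : F →ₐ[ZMod p] ResidueField A :=
    IsSplittingField.lift F (X ^ Fintype.card F - X : (ZMod p)[X]) (by
      have h1 : (X ^ Fintype.card F - X : (ZMod p)[X]).map (algebraMap (ZMod p) (ResidueField A)) =
          X * (X ^ (Fintype.card F - 1) - 1) := by
        simp only [Polynomial.map_sub, Polynomial.map_pow, map_X, mul_sub, mul_one]
        rw [← pow_succ', Nat.sub_add_cancel Fintype.card_pos]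
      rw [h1, hprod]
      exact Splits.X.mul (Splits.prod fun _ _ => Splits.X_sub_C _))
  obtain ⟨u, hu⟩ := IsCyclic.exists_generator (α := Fˣ)
  have hι : ∃ x ∈ nthRootsFinset (Fintype.card F - 1) (1 : A), ι u = residue A x := by
    have h1 := congrArg (eval (ι u)) hprod
    rw [eval_prod, eval_sub, eval_pow, eval_X, eval_one, ← map_pow,
      FiniteField.pow_card_sub_one_eq_one _ u.ne_zero, map_one, sub_self] at h1
    obtain ⟨x, hx, hx'⟩ := Finset.prod_eq_zero_iff.1 h1.symm
    exact ⟨x, hx, by simpa [sub_eq_zero] using hx'⟩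
  obtain ⟨x, hx, hιx⟩ := hι
  rw [mem_nthRootsFinset hq] at hx
  have hx1 : (x : K) ^ (Fintype.card F - 1) = 1 := congrArg Subtype.val hx
  have hx0 : IsUnit (x : K) := IsUnit.of_pow_eq_one hx1 hq.ne'
  have hxr : hx0.unit ∈ rootsOfUnity (Fintype.card Fˣ) K := by
    rw [mem_rootsOfUnity, Fintype.card_units]
    ext
    simpa using hx1
  refine ⟨MulChar.ofRootOfUnity hxr hu, ι, fun y => ?_⟩
  rcases eq_or_ne y 0 with rfl | hy
  · refine ⟨by rw [MulChar.map_zero]; exact zero_mem _, ?_⟩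
    rw [show (ι : F →+* ResidueField A) 0 = 0 from map_zero _, residue_eq_zero_iff, A.valuation_lt_one_iff]
    simp [MulChar.map_zero]
  · obtain ⟨n, hn⟩ := mem_powers_iff_mem_zpowers.2 (hu (Units.mk0 y hy))
    have hy' : y = (u : F) ^ n := by
      have := congrArg Units.val hn
      simpa using this.symm
    have h1 : MulChar.ofRootOfUnity hxr hu y = ((x ^ n : A) : K) := by
      rw [hy', map_pow, MulChar.ofRootOfUnity_spec]
      rfl
    refine ⟨h1 ▸ (x ^ n).2, ?_⟩
    have h2 : (⟨MulChar.ofRootOfUnity hxr hu y, h1 ▸ (x ^ n).2⟩ : A) = x ^ n := Subtype.ext h1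
    rw [h2, map_pow, ← hιx, ← map_pow, ← hy']
    rfl

end ValuationSubring

end

section

open IsLocalRing

theorem FiniteField.sum_inv_mul_trace {p : ℕ} [Fact p.Prime] (F : Type*) [Field F] [Fintype F]
    [Algebra (ZMod p) F] :
    ∑ a : F, a⁻¹ * algebraMap (ZMod p) F (Algebra.trace (ZMod p) F a) = -1 := by
  classical
  have hp : p.Prime := Fact.out
  have hcard : Fintype.card F = p ^ Module.finrank (ZMod p) F := by
    rw [Module.card_eq_pow_finrank (K := ZMod p), ZMod.card]
  have hf : 0 < Module.finrank (ZMod p) F := Module.finrank_pos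
  simp_rw [FiniteField.algebraMap_trace_eq_sum_pow, Nat.card_zmod, Finset.mul_sum]
  rw [Finset.sum_comm, Finset.sum_eq_single_of_mem 0 (Finset.mem_range.2 hf)]
  · rw [Fintype.sum_eq_add_sum_compl 0]
    simp only [pow_zero, pow_one, inv_zero, zero_mul, zero_add]
    rw [Finset.sum_congr rfl (g := fun _ => (1 : F)) fun x hx => inv_mul_cancel₀ (by simpa using hx)]
    rw [Finset.sum_const, Finset.card_compl, Finset.card_singleton, nsmul_one,
      Nat.cast_sub Fintype.card_pos, FiniteField.cast_card_eq_zero]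
    simp
  · intro i hi hi0
    have hpi : 1 < p ^ i := Nat.one_lt_pow hi0 hp.one_lt
    rw [← FiniteField.sum_pow_lt_card_sub_one F (p ^ i - 1)]
    · refine Finset.sum_congr rfl fun a _ => ?_
      rcases eq_or_ne a 0 with rfl | ha
      · rw [inv_zero, zero_mul, zero_pow (by omega)]
      · rw [inv_mul_eq_iff_eq_mul₀ ha, ← pow_succ', Nat.sub_add_cancel hpi.le]
    · rw [hcard]
      exact Nat.sub_lt_sub_right hpi.le (Nat.pow_lt_pow_right hp.one_lt (Finset.mem_range.1 hi))

namespace ValuationSubring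

variable {K : Type*} [Field K] {A : ValuationSubring K} {p : ℕ} [hp : Fact p.Prime]

theorem valuation_geom_sum_eq_one (hA : A.valuation p < 1) {ζ : K} (hζ : ζ ^ p = 1) {i : ℕ}
    (hi : ¬ p ∣ i) : A.valuation (∑ j ∈ Finset.range i, ζ ^ j) = 1 := by
  have hm : ζ ∈ A := (A.valuation_le_one_iff ζ).1
    (valuation_eq_one_of_pow_eq_one hp.out.ne_zero hζ).le
  have hk := charP_residueField hp.out hA
  have h1 : residue A ⟨ζ, hm⟩ = 1 := by
    rw [← map_one (residue A), residue_eq_residue_iff]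
    exact valuation_sub_one_lt_one hp.out hA (k := 1) (by simpa using hζ)
  have h2 : residue A (∑ j ∈ Finset.range i, (⟨ζ, hm⟩ : A) ^ j) = i := by
    simp only [map_sum, map_pow, h1, one_pow, Finset.sum_const, Finset.card_range, nsmul_one]
  have h3 := (A.valuation_eq_one_iff (∑ j ∈ Finset.range i, (⟨ζ, hm⟩ : A) ^ j)).1 <| by
    rw [← residue_ne_zero_iff_isUnit, h2, Ne, CharP.cast_eq_zero_iff _ p]
    exact hi
  simpa using h3

theorem valuation_sub_one_pow (hA : A.valuation p < 1) {ζ : K} (hζ : IsPrimitiveRoot ζ p) :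
    A.valuation (ζ - 1) ^ (p - 1) = A.valuation p := by
  obtain ⟨n, rfl⟩ : ∃ n, p = n + 1 := ⟨p - 1, (Nat.sub_add_cancel hp.out.one_le).symm⟩
  have h1 := congrArg A.valuation hζ.prod_one_sub_pow_eq_order
  rw [← Nat.cast_succ, map_prod] at h1
  rw [← h1, Nat.add_sub_cancel, Finset.prod_congr rfl (g := fun _ => A.valuation (ζ - 1)) fun k hk => ?_]
  · rw [Finset.prod_const, Finset.card_range]
  · rw [Valuation.map_sub_swap, ← geom_sum_mul, map_mul,
      valuation_geom_sum_eq_one hA hζ.pow_eq_one, one_mul]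
    exact Nat.not_dvd_of_pos_of_lt k.succ_pos (Nat.succ_lt_succ (Finset.mem_range.1 hk))

theorem valuation_gaussSum_teichmuller (hA : A.valuation p < 1) {F : Type*} [Field F] [Fintype F]
    [Algebra (ZMod p) F] (hF : 2 < Fintype.card F) {ζ : K} (hζ : IsPrimitiveRoot ζ p)
    {ψ : AddChar F K} (hψ : ∀ x, ψ x = ζ ^ (Algebra.trace (ZMod p) F x).val)
    {ω : MulChar F K} {ι : F →+* ResidueField A}
    (hω : ∀ x, ∃ hx : ω x ∈ A, residue A ⟨ω x, hx⟩ = ι x) :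
    A.valuation (gaussSum ω⁻¹ ψ) = A.valuation (ζ - 1) := by
  classical
  choose hm hι using hω
  have hζm : ζ ∈ A := (A.valuation_le_one_iff ζ).1
    (valuation_eq_one_of_pow_eq_one hp.out.ne_zero hζ.pow_eq_one).le
  have hk := charP_residueField hp.out hA
  have hζ1 : residue A ⟨ζ, hζm⟩ = 1 := by
    rw [← map_one (residue A), residue_eq_residue_iff]
    exact valuation_sub_one_lt_one hp.out hA (k := 1) (by simpa using hζ.pow_eq_one)
  have hne : ω⁻¹ ≠ 1 := by
    intro h
    obtain ⟨a, ha⟩ : ∃ a : F, a ∉ ({0, 1} : Finset F) := by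
      by_contra! h2
      exact hF.not_ge ((Finset.card_le_card fun a _ => h2 a).trans Finset.card_le_two)
    simp only [Finset.mem_insert, Finset.mem_singleton, not_or] at ha
    have h1 : ω a = 1 := by
      rw [inv_eq_one.1 h, MulChar.one_apply (Ne.isUnit ha.1)]
    have h2 : (⟨ω a, hm a⟩ : A) = 1 := Subtype.ext h1
    have h3 := hι a
    rw [h2, map_one] at h3
    exact ha.2 (ι.injective (by rw [← h3, map_one]))
  let G : A := ∑ a : F, ⟨ω a⁻¹, hm a⁻¹⟩ *
    ∑ i ∈ Finset.range (Algebra.trace (ZMod p) F a).val, ⟨ζ, hζm⟩ ^ i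
  have hG : gaussSum ω⁻¹ ψ = G * (ζ - 1) := by
    have h1 := MulChar.sum_eq_zero_of_ne_one hne
    have h2 : gaussSum ω⁻¹ ψ = ∑ a : F, ω⁻¹ a * (ψ a - 1) := by
      simp_rw [mul_sub, mul_one, Finset.sum_sub_distrib, h1, sub_zero]
      rfl
    rw [h2]
    simp only [G, AddSubmonoidClass.coe_finsetSum, MulMemClass.coe_mul, SubmonoidClass.coe_pow,
      Finset.sum_mul]
    refine Finset.sum_congr rfl fun a _ => ?_
    rw [mul_assoc, geom_sum_mul, hψ, MulChar.inv_apply']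
  have hres : residue A G = -1 := by
    have h1 := congrArg ι (FiniteField.sum_inv_mul_trace (p := p) F)
    rw [map_neg, map_one, map_sum] at h1
    rw [← h1, map_sum]
    refine Finset.sum_congr rfl fun a _ => ?_
    rw [map_mul, hι, map_mul, map_sum]
    congr 1
    simp only [map_pow, hζ1, one_pow, Finset.sum_const, Finset.card_range, nsmul_one]
    conv_rhs => rw [← ZMod.natCast_zmod_val (Algebra.trace (ZMod p) F a), map_natCast, map_natCast]
  have hu : A.valuation G = 1 := by
    rw [← A.valuation_eq_one_iff, ← residue_ne_zero_iff_isUnit, hres]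
    exact neg_ne_zero.2 one_ne_zero
  rw [hG, map_mul, hu, one_mul]

end ValuationSubring

end

theorem gaussSum_pow_char {p : ℕ} [hp : Fact p.Prime] {F K : Type*} [Field F] [Fintype F]
    [Algebra (ZMod p) F] [CommRing K] {ζ : K} {ψ : AddChar F K}
    (hψ : ∀ x, ψ x = ζ ^ (Algebra.trace (ZMod p) F x).val) (χ : MulChar F K) :
    gaussSum (χ ^ p) ψ = gaussSum χ ψ := by
  have hc : CharP F p := charP_of_injective_algebraMap (algebraMap (ZMod p) F).injective p
  let σ := FiniteField.frobeniusAlgEquivOfAlgebraic (ZMod p) F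
  have hσ : ∀ x, σ x = x ^ p := fun x => by simp [σ, ZMod.card]
  unfold gaussSum
  refine Fintype.sum_equiv σ.toEquiv _ _ fun x => ?_
  have h1 : ψ (σ x) = ψ x := by rw [hψ, hψ, Algebra.trace_eq_of_algEquiv σ]
  change _ = χ (σ x) * ψ (σ x)
  rw [h1, hσ, MulChar.pow_apply' _ hp.out.ne_zero, map_pow]

theorem gaussSum_pow_char_pow {p : ℕ} [hp : Fact p.Prime] {F K : Type*} [Field F] [Fintype F]
    [Algebra (ZMod p) F] [CommRing K] {ζ : K} {ψ : AddChar F K}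
    (hψ : ∀ x, ψ x = ζ ^ (Algebra.trace (ZMod p) F x).val) (χ : MulChar F K) (j : ℕ) :
    gaussSum (χ ^ p ^ j) ψ = gaussSum χ ψ := by
  induction j with
  | zero => rw [pow_zero, pow_one]
  | succ j ih => rw [pow_succ, pow_mul, gaussSum_pow_char hψ, ih]

namespace ValuationSubring

variable {K : Type*} [Field K] {A : ValuationSubring K} {F : Type*} [Field F] [Fintype F]

theorem valuation_mulChar_eq_one (χ : MulChar F K) {a : F} (ha : a ≠ 0) :
    A.valuation (χ a) = 1 := by
  refine valuation_eq_one_of_pow_eq_one (Nat.sub_pos_of_lt (Fintype.one_lt_card (α := F))).ne' ?_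
  rw [← map_pow, FiniteField.pow_card_sub_one_eq_one a ha, map_one]

theorem valuation_mulChar_le_one (χ : MulChar F K) (a : F) : A.valuation (χ a) ≤ 1 := by
  rcases eq_or_ne a 0 with rfl | ha
  · simp [MulChar.map_zero]
  · exact (valuation_mulChar_eq_one χ ha).le

theorem valuation_addChar_eq_one (ψ : AddChar F K) (a : F) : A.valuation (ψ a) = 1 := by
  refine valuation_eq_one_of_pow_eq_one (Fintype.card_ne_zero (α := F)) ?_
  rw [← AddChar.map_nsmul_eq_pow, card_nsmul_eq_zero, AddChar.map_zero_eq_one]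

theorem valuation_jacobiSum_le_one (χ φ : MulChar F K) : A.valuation (jacobiSum χ φ) ≤ 1 :=
  Valuation.map_sum_le _ fun _ _ => by
    rw [map_mul]
    exact mul_le_one' (valuation_mulChar_le_one _ _) (valuation_mulChar_le_one _ _)

theorem valuation_gaussSum_le_one (χ : MulChar F K) (ψ : AddChar F K) :
    A.valuation (gaussSum χ ψ) ≤ 1 :=
  Valuation.map_sum_le _ fun _ _ => by
    rw [map_mul]
    exact mul_le_one' (valuation_mulChar_le_one _ _) (valuation_addChar_eq_one _ _).le

theorem mul_valuation_gaussSum_le (χ φ : MulChar F K) {ψ : AddChar F K} (hψ : ψ ≠ 1) :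
    A.valuation (gaussSum χ ψ) * A.valuation (gaussSum φ ψ) ≤
      A.valuation (gaussSum (χ * φ) ψ) := by
  by_cases h : χ * φ = 1
  · rw [h, gaussSum_one_left hψ, Valuation.map_neg, map_one]
    exact mul_le_one' (valuation_gaussSum_le_one _ _) (valuation_gaussSum_le_one _ _)
  · rw [← map_mul, ← jacobiSum_mul_nontrivial h, map_mul]
    exact mul_le_of_le_one_right' (valuation_jacobiSum_le_one _ _)

theorem valuation_gaussSum_pow_le (χ : MulChar F K) {ψ : AddChar F K} (hψ : ψ ≠ 1) (n : ℕ) :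
    A.valuation (gaussSum χ ψ) ^ n ≤ A.valuation (gaussSum (χ ^ n) ψ) := by
  induction n with
  | zero => rw [pow_zero, pow_zero, gaussSum_one_left hψ, Valuation.map_neg, map_one]
  | succ n ih =>
    rw [pow_succ, pow_succ]
    exact (mul_le_mul_left ih _).trans (mul_valuation_gaussSum_le _ _ hψ)

theorem valuation_gaussSum_pow_sum_le {p : ℕ} [Fact p.Prime] [Algebra (ZMod p) F] {ζ : K}
    {ψ : AddChar F K} (hψ : ∀ x, ψ x = ζ ^ (Algebra.trace (ZMod p) F x).val) (hψ1 : ψ ≠ 1)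
    (χ : MulChar F K) {ι : Type*} (s : Finset ι) (d e : ι → ℕ) :
    A.valuation (gaussSum χ ψ) ^ ∑ j ∈ s, d j ≤
      A.valuation (gaussSum (χ ^ ∑ j ∈ s, d j * p ^ e j) ψ) := by
  classical
  induction s using Finset.induction_on with
  | empty => simp [gaussSum_one_left hψ1]
  | insert j s hj ih =>
    rw [Finset.sum_insert hj, Finset.sum_insert hj, pow_add, pow_add]
    refine (mul_le_mul' ?_ ih).trans (mul_valuation_gaussSum_le _ _ hψ1)
    rw [pow_mul, gaussSum_pow_char_pow hψ]
    exact valuation_gaussSum_pow_le _ hψ1 _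

end ValuationSubring

namespace Nat

/-- The sum of the least nonnegative residues modulo `N` of `a, p * a, …, p ^ (f - 1) * a`. -/
def orbitSum (N p f a : ℕ) : ℕ := ∑ j ∈ Finset.range f, p ^ j * a % N

theorem mul_div_add_pow_succ_mod (N p a j : ℕ) :
    N * (p * (p ^ j * a % N) / N) + p ^ (j + 1) * a % N = p * (p ^ j * a % N) := by
  have h : p ^ (j + 1) * a % N = p * (p ^ j * a % N) % N := by
    rw [pow_succ', mul_assoc, Nat.mul_mod_mod]
  rw [h, Nat.div_add_mod]

theorem mul_sum_digits_add (N p a f : ℕ) :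
    N * ∑ j ∈ Finset.range f, p * (p ^ j * a % N) / N * p ^ (f - 1 - j) + p ^ f * a % N =
      p ^ f * (a % N) := by
  induction f with
  | zero => simp
  | succ f ih =>
    rw [Finset.sum_range_succ, Nat.add_sub_cancel, Nat.sub_self, pow_zero, mul_one, mul_add,
      add_assoc, mul_div_add_pow_succ_mod, pow_succ', mul_assoc, ← ih, mul_add,
      Nat.mul_left_comm p N, Finset.mul_sum _ _ p]
    congr 2
    refine Finset.sum_congr rfl fun j hj => ?_
    have hj := Finset.mem_range.1 hj
    rw [show f - j = f - 1 - j + 1 by omega, pow_succ]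
    ring

theorem mul_sum_digits {N p f a : ℕ} (ha : a < N) (hf : p ^ f % N = 1 % N) :
    N * ∑ j ∈ Finset.range f, p * (p ^ j * a % N) / N * p ^ (f - 1 - j) = (p ^ f - 1) * a := by
  have h := mul_sum_digits_add N p a f
  rw [Nat.mul_mod, hf, ← Nat.mul_mod, one_mul, Nat.mod_eq_of_lt ha] at h
  rw [Nat.sub_mul, one_mul, ← h, Nat.add_sub_cancel]

theorem mul_sum_digits_eq_orbitSum {N p f a : ℕ} (hf : p ^ f % N = 1 % N) :
    N * ∑ j ∈ Finset.range f, p * (p ^ j * a % N) / N = (p - 1) * orbitSum N p f a := by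
  have h1 : ∑ j ∈ Finset.range f, p ^ (j + 1) * a % N = orbitSum N p f a := by
    have h2 := Finset.sum_range_succ (fun j => p ^ j * a % N) f
    rw [Finset.sum_range_succ', Nat.mul_mod (p ^ f), hf, ← Nat.mul_mod, pow_zero] at h2
    exact Nat.add_right_cancel h2
  have h2 := Finset.sum_congr rfl fun j (_ : j ∈ Finset.range f) => mul_div_add_pow_succ_mod N p a j
  rw [Finset.sum_add_distrib, ← Finset.mul_sum, ← Finset.mul_sum, h1] at h2
  change _ = p * orbitSum N p f a at h2
  rw [Nat.sub_mul, one_mul, ← h2, Nat.add_sub_cancel]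

theorem mod_add_sub_mod {N b a : ℕ} (ha : a ≤ N) (h : ¬ N ∣ b * a) :
    b * a % N + b * (N - a) % N = N := by
  have hN : 0 < N := Nat.pos_of_ne_zero fun h0 => h <| by
    obtain rfl : a = 0 := by omega
    simp
  have h1 : N ∣ b * a % N + b * (N - a) % N := by
    rw [Nat.dvd_iff_mod_eq_zero, ← Nat.add_mod, ← mul_add, Nat.add_sub_cancel' ha]
    simp
  have h2 : 0 < b * a % N := Nat.pos_of_ne_zero fun h0 => h (Nat.dvd_of_mod_eq_zero h0)
  have h3 := Nat.mod_lt (b * a) hN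
  have h4 := Nat.mod_lt (b * (N - a)) hN
  obtain ⟨c, hc⟩ := h1
  have : c < 2 := by by_contra! hc2; nlinarith
  interval_cases c <;> omega

theorem orbitSum_add_orbitSum_sub {N p f a : ℕ} (hN : 1 < N) (hp : p.Coprime N)
    (ha : a.Coprime N) (haN : a < N) :
    orbitSum N p f a + orbitSum N p f (N - a) = f * N := by
  rw [orbitSum, orbitSum, ← Finset.sum_add_distrib, Finset.sum_congr rfl (g := fun _ => N)]
  · rw [Finset.sum_const, Finset.card_range, smul_eq_mul]
  · intro j _
    refine mod_add_sub_mod haN.le fun h => ?_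
    exact hN.ne' ((((hp.pow_left j).mul_left ha).symm.eq_one_of_dvd h))

theorem dvd_orbitSum {N p f a : ℕ} (hf : p ^ f % N = 1 % N)
    (hNp : N.Coprime (p - 1)) : N ∣ orbitSum N p f a :=
  hNp.dvd_of_dvd_mul_left (Dvd.intro _ (mul_sum_digits_eq_orbitSum hf))

end Nat

theorem MulChar.exists_eq_pow_of_injective {F K : Type*} [Field F] [Fintype F] [Field K]
    {ω : MulChar F K} (hω : ∀ a : F, ω a = 1 → a = 1) (χ : MulChar F K) : ∃ k, χ = ω ^ k := by
  classical
  obtain ⟨u, hu⟩ := IsCyclic.exists_generator (α := Fˣ)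
  have hq : 0 < Fintype.card F - 1 := Nat.sub_pos_of_lt Fintype.one_lt_card
  have : NeZero (Fintype.card F - 1) := ⟨hq.ne'⟩
  have hou : orderOf u = Fintype.card F - 1 := by
    rw [orderOf_eq_card_of_forall_mem_zpowers hu, Nat.card_eq_fintype_card, Fintype.card_units]
  have hpow : ∀ φ : MulChar F K, φ u ^ (Fintype.card F - 1) = 1 := fun φ => by
    rw [← map_pow, FiniteField.pow_card_sub_one_eq_one _ u.ne_zero, map_one]
  have hprim : IsPrimitiveRoot (ω u) (Fintype.card F - 1) := by
    refine ⟨hpow ω, fun l hl => ?_⟩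
    rw [← map_pow] at hl
    rw [← hou, orderOf_dvd_iff_pow_eq_one]
    exact Units.ext (by simpa using hω _ hl)
  obtain ⟨k, -, hk⟩ := hprim.eq_pow_of_pow_eq_one (hpow χ)
  exact ⟨k, (MulChar.eq_iff hu _ _).2 (by rw [MulChar.pow_apply_coe, hk])⟩

theorem orderOf_eq_of_injective_mulChar {F K : Type*} [Field F] [Fintype F] [Field K]
    {ω : MulChar F K} (hω : ∀ a : F, ω a = 1 → a = 1) : orderOf ω = Fintype.card F - 1 := by
  classical
  refine Nat.dvd_antisymm (MulChar.orderOf_dvd_card_sub_one F ω) ?_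
  obtain ⟨u, hu⟩ := IsCyclic.exists_generator (α := Fˣ)
  have hou : orderOf u = Fintype.card F - 1 := by
    rw [orderOf_eq_card_of_forall_mem_zpowers hu, Nat.card_eq_fintype_card, Fintype.card_units]
  rw [← hou, orderOf_dvd_iff_pow_eq_one]
  have h1 : ω ((u ^ orderOf ω : Fˣ) : F) = 1 := by
    rw [Units.val_pow_eq_pow_val, map_pow, ← MulChar.pow_apply_coe, pow_orderOf_eq_one,
      MulChar.one_apply_coe]
  exact Units.ext (hω _ h1)

theorem exists_eq_pow_mul_of_orderOf_eq {G : Type*} [CommGroup G] {g x : G} {N Q k : ℕ}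
    (hN : 0 < N) (hQ : 0 < Q) (hg : orderOf g = Q * N) (hx : orderOf x = N) (hk : x = g ^ k) :
    ∃ a, a < N ∧ a.Coprime N ∧ x = g ^ (Q * a) := by
  have h1 : Q ∣ k := by
    have h2 : g ^ (k * N) = 1 := by rw [pow_mul, ← hk, ← hx, pow_orderOf_eq_one]
    have h3 := orderOf_dvd_of_pow_eq_one h2
    rw [hg] at h3
    exact Nat.dvd_of_mul_dvd_mul_right hN h3
  obtain ⟨b, rfl⟩ := h1
  have hgQ : orderOf (g ^ Q) = N := by
    rw [orderOf_pow_of_dvd hQ.ne' (hg ▸ Dvd.intro _ rfl), hg, Nat.mul_div_cancel_left _ hQ]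
  have hxb : x = (g ^ Q) ^ (b % N) := by rw [hk, pow_mul, ← hgQ, pow_mod_orderOf]
  refine ⟨b % N, Nat.mod_lt _ hN, ?_, by rw [hxb, pow_mul]⟩
  have h4 : orderOf ((g ^ Q) ^ (b % N)) = N := by rw [← hxb, hx]
  have hfin : IsOfFinOrder (g ^ Q) := orderOf_pos_iff.1 (hgQ ▸ hN)
  rw [hfin.orderOf_pow, hgQ] at h4
  have h5 := Nat.div_mul_cancel (Nat.gcd_dvd_left N (b % N))
  rw [h4] at h5
  exact Nat.Coprime.symm (Nat.eq_of_mul_eq_mul_left hN (h5.trans (mul_one N).symm))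

namespace ValuationSubring

open IsLocalRing

variable {K : Type*} [Field K] {A : ValuationSubring K}

theorem eq_of_mul_eq_mul_of_le {Γ : Type*} [LinearOrderedCommGroupWithZero Γ] {x y a b : Γ}
    (hb : b ≠ 0) (hax : a ≤ x) (hby : b ≤ y) (h : x * y = a * b) : x = a := by
  refine le_antisymm (not_lt.1 fun hlt => ?_) hax
  have h1 : a * b < x * b := mul_lt_mul_of_pos_right hlt (zero_lt_iff.2 hb)
  exact absurd h (h1.trans_le (mul_le_mul_right hby x)).ne'

theorem exists_valuation_gaussSum {p : ℕ} [hp : Fact p.Prime] (hA : A.valuation p < 1)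
    (hp0 : A.valuation p ≠ 0)
    {F : Type*} [Field F] [Fintype F] [Algebra (ZMod p) F] {f : ℕ} (hcard : Fintype.card F = p ^ f)
    (hF : 2 < Fintype.card F) {z : K} (hz : IsPrimitiveRoot z (Fintype.card F - 1))
    {ζ : K} (hζ : IsPrimitiveRoot ζ p)
    {ψ : AddChar F K} (hψ : ∀ x, ψ x = ζ ^ (Algebra.trace (ZMod p) F x).val) (hψ1 : ψ ≠ 1)
    {χ : MulChar F K} {N : ℕ} (hχ : orderOf χ = N) (hN : 1 < N) (hpN : p.Coprime N)
    (hNp : N.Coprime (p - 1))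
    (hprod : A.valuation (gaussSum χ ψ * gaussSum χ⁻¹ ψ) = A.valuation p ^ f) :
    ∃ a i i' : ℕ, a < N ∧ a.Coprime N ∧ Nat.orbitSum N p f a = N * i ∧
      Nat.orbitSum N p f (N - a) = N * i' ∧ A.valuation (gaussSum χ ψ) = A.valuation p ^ i ∧
      A.valuation (gaussSum χ⁻¹ ψ) = A.valuation p ^ i' := by
  have := charP_residueField hp.out hA
  obtain ⟨ω, ι, hω⟩ := exists_teichmuller (p := p) (A := A) hz
  have hinj : ∀ a : F, ω a = 1 → a = 1 := fun a ha => by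
    obtain ⟨hm, h⟩ := hω a
    have h2 : (⟨ω a, hm⟩ : A) = 1 := Subtype.ext ha
    rw [h2, map_one] at h
    exact ι.injective (by rw [← h, map_one])
  have hg : orderOf ω⁻¹ = p ^ f - 1 := by
    rw [orderOf_inv, orderOf_eq_of_injective_mulChar hinj, hcard]
  obtain ⟨k, hk⟩ := MulChar.exists_eq_pow_of_injective hinj χ⁻¹
  have hk' : χ = ω⁻¹ ^ k := by rw [inv_pow, ← hk, inv_inv]
  have hdvd : N ∣ p ^ f - 1 := hcard ▸ hχ ▸ MulChar.orderOf_dvd_card_sub_one F χ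
  have hmod : p ^ f % N = 1 % N :=
    ((Nat.modEq_iff_dvd' (Nat.one_le_pow _ _ hp.out.pos)).2 hdvd).symm
  obtain ⟨Q, hQ⟩ := hdvd
  rw [mul_comm] at hQ
  have hN0 : 0 < N := by omega
  have hQ0 : 0 < Q := Nat.pos_of_ne_zero fun h => by
    rw [h, zero_mul, ← hcard] at hQ; omega
  obtain ⟨a, haN, haco, hχa⟩ := exists_eq_pow_mul_of_orderOf_eq hN0 hQ0 (hg.trans hQ) hχ hk'
  have hχa' : χ⁻¹ = ω⁻¹ ^ (Q * (N - a)) := by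
    rw [inv_eq_iff_mul_eq_one, hχa, ← pow_add, ← mul_add, Nat.add_sub_cancel' haN.le, ← hQ, ← hg,
      pow_orderOf_eq_one]
  have key : ∀ b i, b < N → Nat.orbitSum N p f b = N * i →
      A.valuation p ^ i ≤ A.valuation (gaussSum (ω⁻¹ ^ (Q * b)) ψ) := fun b i hb hi => by
    have h1 := Nat.mul_sum_digits (p := p) hb hmod
    have h2 := Nat.mul_sum_digits_eq_orbitSum (p := p) (a := b) hmod
    rw [hQ, mul_comm Q, mul_assoc] at h1
    have h1 := Nat.eq_of_mul_eq_mul_left hN0 h1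
    rw [hi, Nat.mul_left_comm] at h2
    have h2 := Nat.eq_of_mul_eq_mul_left hN0 h2
    rw [← h1, ← valuation_sub_one_pow hA hζ, ← pow_mul, ← h2,
      ← valuation_gaussSum_teichmuller hA hF hζ hψ hω]
    exact valuation_gaussSum_pow_sum_le hψ hψ1 _ _ _ _
  obtain ⟨i, hi⟩ := Nat.dvd_orbitSum (a := a) hmod hNp
  obtain ⟨i', hi'⟩ := Nat.dvd_orbitSum (a := N - a) hmod hNp
  have ha0 : 0 < a := Nat.pos_of_ne_zero fun h => by
    rw [h, Nat.coprime_zero_left] at haco; omega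
  have hii : i + i' = f := by
    have h := Nat.orbitSum_add_orbitSum_sub (f := f) hN hpN haco haN
    rw [hi, hi', ← mul_add, mul_comm] at h
    exact Nat.eq_of_mul_eq_mul_right hN0 h
  have k1 := key a i haN hi
  have k2 := key (N - a) i' (by omega) hi'
  rw [← hχa] at k1
  rw [← hχa'] at k2
  rw [map_mul, ← hii, pow_add] at hprod
  refine ⟨a, i, i', haN, haco, hi, hi', ?_, ?_⟩
  · exact eq_of_mul_eq_mul_of_le (pow_ne_zero _ hp0) k1 k2 hprod
  · exact eq_of_mul_eq_mul_of_le (pow_ne_zero _ hp0) k2 k1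
      (by rw [mul_comm, hprod, mul_comm])

end ValuationSubring

theorem Nat.exists_modEq_pow_of_orderOf_eq_totient {M p : ℕ} (hM : 0 < M) (hp : p.Coprime M)
    (hord : orderOf (p : ZMod M) = M.totient) {c : ℕ} (hc : c.Coprime M) :
    ∃ j, c ≡ p ^ j [MOD M] := by
  have : NeZero M := ⟨hM.ne'⟩
  let u := ZMod.unitOfCoprime p hp
  have hu : orderOf u = Nat.card (ZMod M)ˣ := by
    rw [← orderOf_units, ZMod.coe_unitOfCoprime, hord, Nat.card_eq_fintype_card,
      ZMod.card_units_eq_totient]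
  have h1 : ZMod.unitOfCoprime c hc ∈ Subgroup.zpowers u := by
    rw [(Subgroup.card_eq_iff_eq_top _).1 (Nat.card_zpowers u |>.trans hu)]
    trivial
  obtain ⟨j, hj⟩ := mem_powers_iff_mem_zpowers.2 h1
  refine ⟨j, (ZMod.natCast_eq_natCast_iff _ _ _).1 ?_⟩
  simpa [u] using (congrArg Units.val hj).symm

theorem jacobiSym_congr {D N c d : ℕ} (hDN : D ∣ N) (h : c ≡ d [MOD N]) :
    jacobiSym c D = jacobiSym d D := by
  rw [jacobiSym.mod_left, ← Int.natCast_mod, h.of_dvd hDN, Int.natCast_mod, ← jacobiSym.mod_left]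

theorem jacobiSym_mod {D N : ℕ} (hDN : D ∣ N) (c : ℕ) :
    jacobiSym (c % N : ℕ) D = jacobiSym c D :=
  jacobiSym_congr hDN (Nat.mod_modEq c N)

theorem jacobiSym_prime_of_orderOf_eq_totient {r n p : ℕ} (hr : r.Prime) (hr2 : r ≠ 2) (hn : n ≠ 0)
    (hp : p.Coprime r) (hord : orderOf (p : ZMod (r ^ n)) = (r ^ n).totient) :
    jacobiSym p r = -1 := by
  have : Fact r.Prime := ⟨hr⟩
  refine (jacobiSym.eq_one_or_neg_one (by rwa [Int.gcd_natCast_natCast])).resolve_left fun h => ?_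
  obtain ⟨a, ha⟩ := quadraticChar_exists_neg_one (F := ZMod r) (by rwa [ZMod.ringChar_zmod_n])
  have ha' : jacobiSym a.val r = -1 := by
    rw [← jacobiSym.legendreSym.to_jacobiSym, legendreSym, Int.cast_natCast, ZMod.natCast_zmod_val,
      ha]
  have hco : a.val.Coprime r := by
    have h0 : jacobiSym a.val r ≠ 0 := by rw [ha']; decide
    rw [Ne, jacobiSym.eq_zero_iff, not_and, not_not, Int.gcd_natCast_natCast] at h0
    exact h0 hr.ne_zero
  obtain ⟨j, hj⟩ := Nat.exists_modEq_pow_of_orderOf_eq_totient (pow_pos hr.pos n)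
    (hp.pow_right n) hord (hco.pow_right n)
  rw [jacobiSym_congr (dvd_pow_self r hn) hj, Nat.cast_pow, jacobiSym.pow_left, h, one_pow] at ha'
  norm_num at ha'

/-- The powers of `p` form a subgroup of index two in `(ZMod N)ˣ`, contained in the kernel of the
odd quadratic character `jacobiSym · D`. -/
structure IndexTwo (D N p f : ℕ) : Prop where
  dvd : D ∣ N
  one_lt : 1 < N
  coprime_of_coprime : ∀ c : ℕ, c.Coprime D → c.Coprime N
  orderOf_eq : f = orderOf (p : ZMod N)
  two_mul_eq : 2 * f = N.totient
  coprime : p.Coprime N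
  jacobiSym_eq_one : jacobiSym p D = 1
  mod_four : D % 4 = 3

namespace IndexTwo

variable {D N p f : ℕ}

theorem jacobiSym_mul_sub (H : IndexTwo D N p f) {a : ℕ} (ha : a ≤ N) (j : ℕ) :
    jacobiSym (p ^ j * (N - a) : ℕ) D = - jacobiSym a D := by
  have h1 : ((p ^ j * (N - a) : ℕ) : ℤ) = p ^ j * (-1 * (a - N)) := by
    push_cast [ha]; ring
  have h4 := H.mod_four
  have hodd : Odd D := Nat.odd_iff.2 (by omega)
  obtain ⟨M, hM⟩ := H.dvd
  rw [h1, jacobiSym.mul_left, jacobiSym.pow_left, H.jacobiSym_eq_one, one_pow, one_mul,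
    jacobiSym.mul_left, jacobiSym.at_neg_one hodd, ZMod.χ₄_nat_three_mod_four H.mod_four,
    jacobiSym.mod_left ((a : ℤ) - _), hM, Nat.cast_mul, Int.sub_mul_emod_self_left,
    ← jacobiSym.mod_left, neg_one_mul]

theorem jacobiSym_pow_mul (H : IndexTwo D N p f) (a j : ℕ) :
    jacobiSym (p ^ j * a : ℕ) D = jacobiSym a D := by
  rw [Nat.cast_mul, Nat.cast_pow, jacobiSym.mul_left, jacobiSym.pow_left, H.jacobiSym_eq_one,
    one_pow, one_mul]

theorem jacobiSym_ne_zero_iff (H : IndexTwo D N p f) (c : ℕ) :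
    jacobiSym c D ≠ 0 ↔ c.Coprime N := by
  have h4 := H.mod_four
  rw [Ne, jacobiSym.eq_zero_iff, not_and, not_not, Int.gcd_natCast_natCast]
  exact ⟨fun h => H.coprime_of_coprime c (h (by rintro rfl; omega)),
    fun h _ => h.coprime_dvd_right H.dvd⟩

theorem injOn_pow_mul_mod (H : IndexTwo D N p f) {b : ℕ} (hb : b.Coprime N) :
    Set.InjOn (fun j => p ^ j * b % N) (Finset.range f) := by
  intro i hi j hj (hij : p ^ i * b ≡ p ^ j * b [MOD N])
  have h1 := Nat.ModEq.cancel_right_of_coprime hb.symm hij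
  have h2 := (ZMod.natCast_eq_natCast_iff _ _ _).2 h1
  push_cast at h2
  rw [Finset.mem_coe, Finset.mem_range, H.orderOf_eq] at hi hj
  exact pow_injOn_Iio_orderOf hi hj h2

theorem _root_.Nat.Coprime.self_sub {a : ℕ} (ha : a.Coprime N) (haN : a < N) :
    (N - a).Coprime N :=
  (Nat.coprime_self_sub_left haN.le).2 ha

theorem disjoint_image (H : IndexTwo D N p f) {a : ℕ} (haN : a < N) (ha : a.Coprime N) :
    Disjoint ((Finset.range f).image (fun j => p ^ j * a % N))
        ((Finset.range f).image (fun j => p ^ j * (N - a) % N)) := by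
  have h0 := (H.jacobiSym_ne_zero_iff a).2 ha
  rw [Finset.disjoint_left]
  intro x hx hx'
  obtain ⟨i, -, rfl⟩ := Finset.mem_image.1 hx
  obtain ⟨j, -, hij⟩ := Finset.mem_image.1 hx'
  have h1 := jacobiSym_congr H.dvd hij
  rw [H.jacobiSym_mul_sub haN.le, H.jacobiSym_pow_mul] at h1
  omega

theorem filter_coprime_eq_union (H : IndexTwo D N p f) {a : ℕ} (haN : a < N) (ha : a.Coprime N) :
    (Finset.range N).filter N.Coprime =
      (Finset.range f).image (fun j => p ^ j * a % N) ∪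
        (Finset.range f).image (fun j => p ^ j * (N - a) % N) := by
  have hN : 0 < N := by have := H.one_lt; omega
  have hmem : ∀ b, b.Coprime N → (Finset.range f).image (fun j => p ^ j * b % N) ⊆
      (Finset.range N).filter N.Coprime := by
    intro b hb x hx
    obtain ⟨i, -, rfl⟩ := Finset.mem_image.1 hx
    refine Finset.mem_filter.2 ⟨Finset.mem_range.2 (Nat.mod_lt _ hN), ?_⟩
    rw [Nat.Coprime, Nat.gcd_comm, ← Nat.gcd_rec]
    exact (((H.coprime.pow_left i).mul_left hb).symm)
  refine (Finset.eq_of_subset_of_card_le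
    (Finset.union_subset (hmem a ha) (hmem _ (ha.self_sub haN))) ?_).symm
  rw [Finset.card_union_of_disjoint (H.disjoint_image haN ha),
    Finset.card_image_of_injOn (H.injOn_pow_mul_mod ha),
    Finset.card_image_of_injOn (H.injOn_pow_mul_mod (ha.self_sub haN)),
    ← Nat.totient_eq_card_coprime, ← H.two_mul_eq, Finset.card_range, two_mul]

theorem exists_modEq (H : IndexTwo D N p f) {c : ℕ} (hc : c.Coprime N) :
    (jacobiSym c D = 1 ∧ ∃ j, c ≡ p ^ j [MOD N]) ∨
      (jacobiSym c D = -1 ∧ ∃ j, c ≡ p ^ j * (N - 1) [MOD N]) := by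
  have hN := H.one_lt
  have h1 : c % N ∈ (Finset.range N).filter N.Coprime := by
    refine Finset.mem_filter.2 ⟨Finset.mem_range.2 (Nat.mod_lt _ (by omega)), ?_⟩
    rw [Nat.Coprime, Nat.gcd_comm, ← Nat.gcd_rec]
    exact hc.symm
  rw [H.filter_coprime_eq_union hN (Nat.coprime_one_left N), Finset.mem_union] at h1
  rcases h1 with h1 | h1 <;> obtain ⟨j, -, hj⟩ := Finset.mem_image.1 h1
  · refine Or.inl ⟨?_, j, by simpa using (show _ ≡ _ [MOD N] from hj).symm⟩
    rw [← jacobiSym_congr H.dvd hj, H.jacobiSym_pow_mul, Nat.cast_one, jacobiSym.one_left]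
  · refine Or.inr ⟨?_, j, (show _ ≡ _ [MOD N] from hj).symm⟩
    rw [← jacobiSym_congr H.dvd hj, H.jacobiSym_mul_sub hN.le, Nat.cast_one, jacobiSym.one_left]

theorem sum_jacobiSym_mul_eq (H : IndexTwo D N p f) {a : ℕ} (haN : a < N) (ha : a.Coprime N) :
    ∑ c ∈ Finset.range N, jacobiSym c D * c =
      jacobiSym a D * (Nat.orbitSum N p f a - Nat.orbitSum N p f (N - a)) := by
  have h1 : ∑ c ∈ Finset.range N, jacobiSym c D * c =
      ∑ c ∈ (Finset.range N).filter N.Coprime, jacobiSym c D * (c : ℤ) := by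
    rw [Finset.sum_filter_of_ne]
    intro c _ hc
    exact ((H.jacobiSym_ne_zero_iff c).1 (left_ne_zero_of_mul hc)).symm
  rw [h1, H.filter_coprime_eq_union haN ha, Finset.sum_union (H.disjoint_image haN ha),
    Finset.sum_image (H.injOn_pow_mul_mod ha),
    Finset.sum_image (H.injOn_pow_mul_mod (ha.self_sub haN))]
  have h2 := H.jacobiSym_mul_sub haN.le 0
  rw [pow_zero, one_mul] at h2
  simp only [jacobiSym_mod H.dvd, H.jacobiSym_pow_mul, h2]
  rw [Nat.orbitSum, Nat.orbitSum, ← Finset.mul_sum, ← Finset.mul_sum]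
  push_cast
  ring

end IndexTwo

theorem sum_range_mul_jacobiSym (D M : ℕ) (h0 : ∑ k ∈ Finset.range D, jacobiSym k D = 0) :
    ∑ c ∈ Finset.range (D * M), jacobiSym c D * c =
      M * ∑ k ∈ Finset.range D, jacobiSym k D * k := by
  induction M with
  | zero => simp
  | succ M ih =>
    rw [mul_add, mul_one, Finset.sum_range_add, ih]
    have h1 : ∀ k, jacobiSym ((D * M + k : ℕ) : ℤ) D = jacobiSym k D := fun k =>
      jacobiSym_congr dvd_rfl (by simp [Nat.ModEq])
    simp only [h1]
    simp only [Nat.cast_add, Nat.cast_mul, mul_add, Finset.sum_add_distrib]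
    rw [← Finset.sum_mul, h0]
    push_cast; ring

theorem IndexTwo.abs_sub_eq_classNumber {D N p f r s : ℕ} (H : IndexTwo D N p f) (hD : D = r * s)
    (hr : r.Prime) (hs : s.Prime) (hrs : r ≠ s) {K : Type*} [Field K] [NumberField K]
    (hK : Module.finrank ℚ K = 2) {α : K} (hα : α ^ 2 = -(D : K)) {a i i' : ℕ} (haN : a < N)
    (ha : a.Coprime N) (hi : Nat.orbitSum N p f a = N * i)
    (hi' : Nat.orbitSum N p f (N - a) = N * i') :
    |(i : ℤ) - i'| = NumberField.classNumber K := by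
  have h4 := H.mod_four
  have hN := H.one_lt
  have hD0 : D ≠ 0 := by omega
  have : NeZero D := ⟨hD0⟩
  have h0 : ∑ k ∈ Finset.range D, jacobiSym k D = 0 := by
    have h1 : jacobiChar D ≠ 1 := by
      intro h1
      have h2 := jacobiChar_odd h4
      rw [DirichletCharacter.Odd, h1, MulChar.one_apply isUnit_one.neg] at h2
      norm_num at h2
    have h2 := MulChar.sum_eq_zero_of_ne_one h1
    have h3 := ZMod.sum_val_eq_sum_range D (fun k => (jacobiSym k D : ℂ))
    rw [← Int.cast_inj (α := ℂ), Int.cast_sum, Int.cast_zero, ← h3, ← h2]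
    refine Finset.sum_congr rfl fun x _ => ?_
    conv_rhs => rw [← ZMod.natCast_zmod_val x, jacobiChar_natCast]
  obtain ⟨M, hM⟩ := H.dvd
  have h1 := H.sum_jacobiSym_mul_eq haN ha
  have h2 := sum_range_mul_jacobiSym D M h0
  rw [← hM, h1, hi, hi'] at h2
  have h3 := classNumber_mul_eq hD hr hs hrs h4 hK hα
  have h5 : |jacobiSym a D| = 1 := by
    rcases jacobiSym.eq_one_or_neg_one (a := a) (b := D) (by
      rw [Int.gcd_natCast_natCast]; exact ha.coprime_dvd_right H.dvd) with h | h <;> rw [h] <;> rfl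
  have h6 := congrArg abs h2
  push_cast at h6
  rw [← mul_sub, abs_mul, abs_mul, abs_mul, h5, ← h3, one_mul, hM] at h6
  have h7 : (D : ℤ) * M ≠ 0 := by
    rw [← Nat.cast_mul, ← hM]
    omega
  rw [Nat.abs_cast, Nat.abs_cast] at h6
  refine mul_left_cancel₀ h7 ?_
  push_cast at h6 ⊢
  rw [h6]
  ring

section

open Polynomial

theorem exists_int_of_isIntegral_rat {x : ℂ} (hx : IsIntegral ℤ x) {r : ℚ} (hr : x = r) :
    ∃ z : ℤ, x = z := by
  have h1 : IsIntegral ℤ r := by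
    rw [← isIntegral_algebraMap_iff (A := ℚ) (B := ℂ) (algebraMap ℚ ℂ).injective]
    simpa [hr] using hx
  obtain ⟨z, hz⟩ := IsIntegrallyClosed.isIntegral_iff.1 h1
  exact ⟨z, by rw [hr, ← hz]; simp⟩

/-- An integral polynomial expression in a root of unity that is invariant under the Galois
conjugations `ζ ↦ ζ ^ a` is an integer. -/
theorem exists_int_of_aeval_pow_eq {n : ℕ} (hn : 0 < n) {ζ : ℂ} (hζ : IsPrimitiveRoot ζ n) (P : ℤ[X])
    (h : ∀ a : ℕ, a.Coprime n → aeval (ζ ^ a) P = aeval ζ P) : ∃ z : ℤ, aeval ζ P = z := by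
  have : NeZero n := ⟨hn.ne'⟩
  have hint : IsIntegral ℤ ζ := hζ.isIntegral hn
  have hP : IsIntegral ℤ (aeval ζ P) := by
    rw [aeval_eq_sum_range]
    exact IsIntegral.sum _ fun i _ => (hint.pow i).smul _
  let L := IntermediateField.adjoin ℚ {ζ}
  have : IsCyclotomicExtension {n} ℚ L := by
    have h1 : IsCyclotomicExtension {n} ℚ (Algebra.adjoin ℚ {ζ}) := hζ.adjoin_isCyclotomicExtension ℚ
    have h2 : L.toSubalgebra = Algebra.adjoin ℚ {ζ} :=
      IntermediateField.adjoin_simple_toSubalgebra_of_isAlgebraic hint.tower_top.isAlgebraic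
    change IsCyclotomicExtension {n} ℚ L.toSubalgebra
    rwa [h2]
  have : IsGalois ℚ L := IsCyclotomicExtension.isGalois {n} ℚ L
  have : FiniteDimensional ℚ L := IsCyclotomicExtension.finiteDimensional {n} ℚ L
  let z : L := IntermediateField.AdjoinSimple.gen ℚ ζ
  have hz : algebraMap L ℂ z = ζ := IntermediateField.AdjoinSimple.algebraMap_gen ℚ ζ
  have hzp : IsPrimitiveRoot z n :=
    IsPrimitiveRoot.of_map_of_injective (f := algebraMap L ℂ) (by rwa [hz])
      (algebraMap L ℂ).injective
  have h1 : aeval z P ∈ (⊥ : IntermediateField ℚ L) := by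
    rw [IsGalois.mem_bot_iff_fixed]
    intro σ
    obtain ⟨a, -, ha, haz⟩ := (hzp.isPrimitiveRoot_iff).1 (hzp.map_of_injective σ.injective)
    apply (algebraMap L ℂ).injective
    have h2 : σ (aeval z P) = aeval (σ z) P := (aeval_algHom_apply (σ.restrictScalars ℤ) z P).symm
    rw [h2, ← haz, ← aeval_algebraMap_apply, ← aeval_algebraMap_apply, map_pow, hz]
    exact h a ha
  obtain ⟨r, hr⟩ := IntermediateField.mem_bot.1 h1
  refine exists_int_of_isIntegral_rat hP (r := r) ?_
  rw [← hz, aeval_algebraMap_apply, ← hr]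
  simp

end

section

open Polynomial

variable {p N : ℕ} [hp : Fact p.Prime] {F : Type*} [Field F] [CharP F p]

theorem MulChar.natCast_eq_one {R : Type*} [CommRing R] {χ : MulChar F R} (hχ : χ ^ N = 1)
    (hNp : N.Coprime (p - 1)) {a : ℕ} (ha : a.Coprime p) : χ (a : F) = 1 := by
  have h0 : (a : F) ≠ 0 := by
    rw [Ne, CharP.cast_eq_zero_iff F p, ← hp.out.coprime_iff_not_dvd]
    exact ha.symm
  have h1 : χ (a : F) ^ (p - 1) = 1 := by
    have h2 := (ZMod.natCast_eq_natCast_iff _ _ _).2 (Nat.ModEq.pow_totient ha)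
    rw [Nat.totient_prime hp.out] at h2
    have h3 := congrArg (ZMod.castHom dvd_rfl F) h2
    simp only [map_natCast] at h3
    rw [← map_pow, ← Nat.cast_pow, h3, Nat.cast_one, MulChar.map_one]
  have h2 : χ (a : F) ^ N = 1 := by
    have h3 : (χ ^ N) (a : F) = 1 := by rw [hχ, MulChar.one_apply (Ne.isUnit h0)]
    rcases eq_or_ne N 0 with rfl | hN
    · rw [pow_zero]
    · rwa [MulChar.pow_apply' _ hN] at h3
  rw [← orderOf_eq_one_iff]
  exact Nat.eq_one_of_dvd_coprimes hNp (orderOf_dvd_of_pow_eq_one h2) (orderOf_dvd_of_pow_eq_one h1)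

theorem gaussSum_pow_pow [Fintype F] {R : Type*} [CommRing R] {χ : MulChar F R} (hχ : χ ^ N = 1)
    (hNp : N.Coprime (p - 1)) (ψ : AddChar F R) {a : ℕ} (ha : a.Coprime p) :
    gaussSum (χ ^ a) (ψ ^ a) = gaussSum (χ ^ a) ψ := by
  have h0 : (a : F) ≠ 0 := by
    rw [Ne, CharP.cast_eq_zero_iff F p, ← hp.out.coprime_iff_not_dvd]
    exact ha.symm
  have h1 : (χ ^ a) ^ N = 1 := by rw [pow_right_comm, hχ, one_pow]
  have h2 := gaussSum_mulShift (χ ^ a) ψ (Units.mk0 _ h0)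
  rwa [Units.val_mk0, MulChar.natCast_eq_one h1 hNp ha, one_mul, ← AddChar.pow_mulShift] at h2

theorem exists_aeval_eq_gaussSum [Fintype F] {R : Type*} [CommRing R] [IsDomain R] {ζ : R}
    (hζ : IsPrimitiveRoot ζ (N * p)) (hN : N ≠ 0) {χ : MulChar F R} (hχ : χ ^ N = 1)
    (hNp : N.Coprime (p - 1)) (ψ : AddChar F R) :
    ∃ P : ℤ[X], ∀ a : ℕ, a.Coprime (N * p) → aeval (ζ ^ a) P = gaussSum (χ ^ a) ψ := by
  classical
  have : NeZero (N * p) := ⟨mul_ne_zero hN hp.out.ne_zero⟩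
  have h1 : ∀ x : F, x ≠ 0 → ∃ e : ℕ, ζ ^ e = χ x * ψ x := by
    intro x hx
    have h2 : χ x ^ N = 1 := by
      rw [← MulChar.pow_apply' _ hN, hχ, MulChar.one_apply (Ne.isUnit hx)]
    have h3 : ψ x ^ p = 1 := by
      rw [← AddChar.map_nsmul_eq_pow, nsmul_eq_mul, CharP.cast_eq_zero, zero_mul,
        AddChar.map_zero_eq_one]
    obtain ⟨e, -, he⟩ := hζ.eq_pow_of_pow_eq_one (ξ := χ x * ψ x) (by
      rw [mul_pow, pow_mul, h2, one_pow, mul_comm N, pow_mul, h3, one_pow, one_mul])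
    exact ⟨e, he⟩
  choose! e he using h1
  refine ⟨∑ x : F, if x = 0 then 0 else X ^ e x, fun a ha => ?_⟩
  have ha0 : a.Coprime p := ha.coprime_mul_left_right
  have ha1 : a ≠ 0 := by
    rintro rfl
    exact hp.out.one_lt.ne' (Nat.coprime_zero_left p |>.1 ha0)
  rw [← gaussSum_pow_pow hχ hNp ψ ha0, map_sum, gaussSum]
  refine Finset.sum_congr rfl fun x _ => ?_
  split_ifs with hx
  · rw [hx, map_zero, MulChar.map_zero, zero_mul]
  · rw [map_pow, aeval_X, pow_right_comm, he x hx, mul_pow, MulChar.pow_apply' _ ha1,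
      AddChar.pow_apply]

theorem exists_aeval_eq_jacobiSym_mul {D n : ℕ} [NeZero D] (hDn : D ∣ n) (hn : 0 < n) {ζ : ℂ}
    (hζ : IsPrimitiveRoot ζ n) :
    ∃ P : ℤ[X], ∀ a : ℕ, a.Coprime n → aeval (ζ ^ a) P =
      jacobiSym a D * gaussSum (jacobiChar D) ZMod.stdAddChar := by
  have : NeZero n := ⟨hn.ne'⟩
  have h1 : ∀ x : ZMod D, ∃ e : ℕ, ζ ^ e = ZMod.stdAddChar x := by
    intro x
    obtain ⟨m, rfl⟩ := hDn
    obtain ⟨e, -, he⟩ := hζ.eq_pow_of_pow_eq_one (ξ := (ZMod.stdAddChar x : ℂ)) (by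
      rw [pow_mul, ← AddChar.map_nsmul_eq_pow, nsmul_eq_mul, CharP.cast_eq_zero, zero_mul,
        AddChar.map_zero_eq_one, one_pow])
    exact ⟨e, he⟩
  choose e he using h1
  refine ⟨∑ x : ZMod D, C (jacobiSym x.val D) * X ^ e x, fun a ha => ?_⟩
  have haD : a.Coprime D := ha.coprime_dvd_right hDn
  have h2 := gaussSum_mulShift (jacobiChar D) ZMod.stdAddChar (ZMod.unitOfCoprime a haD)
  rw [ZMod.coe_unitOfCoprime, jacobiChar_natCast] at h2
  rw [← h2, ← mul_assoc, ← Int.cast_mul]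
  have h3 : jacobiSym a D * jacobiSym a D = 1 := by
    rcases jacobiSym.eq_one_or_neg_one (a := a) (b := D) (by rwa [Int.gcd_natCast_natCast]) with
      h | h <;> rw [h] <;> rfl
  rw [h3, Int.cast_one, one_mul, map_sum, gaussSum]
  refine Finset.sum_congr rfl fun x _ => ?_
  rw [map_mul, aeval_C, map_pow, aeval_X, pow_right_comm, he x, ← AddChar.mulShift_spec']
  rfl

end

section

open Polynomial

variable {p N D f : ℕ} [hp : Fact p.Prime] {F : Type*} [Field F] [Fintype F]

theorem gaussSum_mul_gaussSum_inv_eq_card [CharP F p] {R : Type*} [CommRing R] [IsDomain R]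
    {χ : MulChar F R} (hχ : χ ^ N = 1) (hχ1 : χ ≠ 1) (hNp : N.Coprime (p - 1)) {ψ : AddChar F R}
    (hψ : ψ.IsPrimitive) : gaussSum χ ψ * gaussSum χ⁻¹ ψ = Fintype.card F := by
  have h1 : (χ⁻¹) ^ N = 1 := by rw [inv_pow, hχ, inv_one]
  have h2 : χ⁻¹ (-1) = 1 := by
    have h3 : ((p - 1 : ℕ) : F) = -1 := by
      rw [Nat.cast_sub hp.out.one_lt.le, CharP.cast_eq_zero, Nat.cast_one, zero_sub]
    rw [← h3]
    exact MulChar.natCast_eq_one h1 hNp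
      ((Nat.coprime_self_sub_left hp.out.one_lt.le).2 (Nat.coprime_one_left p))
  have h4 := gaussSum_mulShift χ⁻¹ ψ (-1)
  rw [Units.val_neg, Units.val_one, h2, one_mul] at h4
  rw [← h4, ← AddChar.inv_mulShift, gaussSum_mul_gaussSum_eq_card hχ1 hψ]

variable [Algebra (ZMod p) F]

theorem IndexTwo.gaussSum_pow (H : IndexTwo D N p f) {R : Type*} [CommRing R] {ζ : R}
    {ψ : AddChar F R} (hψ : ∀ x, ψ x = ζ ^ (Algebra.trace (ZMod p) F x).val) {χ : MulChar F R}
    (hχ : χ ^ N = 1) {a : ℕ} (ha : a.Coprime N) :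
    (jacobiSym a D = 1 ∧ gaussSum (χ ^ a) ψ = gaussSum χ ψ ∧
      gaussSum (χ⁻¹ ^ a) ψ = gaussSum χ⁻¹ ψ) ∨
    (jacobiSym a D = -1 ∧ gaussSum (χ ^ a) ψ = gaussSum χ⁻¹ ψ ∧
      gaussSum (χ⁻¹ ^ a) ψ = gaussSum χ ψ) := by
  have hχ' : χ⁻¹ ^ N = 1 := by rw [inv_pow, hχ, inv_one]
  have h1 : ∀ {η : MulChar F R} {c d : ℕ}, η ^ N = 1 → c ≡ d [MOD N] → η ^ c = η ^ d :=
    fun h hcd => pow_eq_pow_iff_modEq.2 (hcd.of_dvd (orderOf_dvd_of_pow_eq_one h))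
  have h2 : ∀ {η : MulChar F R}, η ^ N = 1 → η ^ (N - 1) = η⁻¹ := fun {η} h =>
    eq_inv_of_mul_eq_one_left (by rw [← pow_succ, Nat.sub_add_cancel H.one_lt.le, h])
  rcases H.exists_modEq ha with ⟨hJ, j, hj⟩ | ⟨hJ, j, hj⟩
  · refine Or.inl ⟨hJ, ?_, ?_⟩
    · rw [h1 hχ hj, gaussSum_pow_char_pow hψ]
    · rw [h1 hχ' hj, gaussSum_pow_char_pow hψ]
  · refine Or.inr ⟨hJ, ?_, ?_⟩
    · rw [h1 hχ hj, mul_comm, pow_mul, h2 hχ, gaussSum_pow_char_pow hψ]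
    · rw [h1 hχ' hj, mul_comm, pow_mul, h2 hχ', inv_inv, gaussSum_pow_char_pow hψ]

theorem IndexTwo.exists_two_mul_gaussSum_eq (H : IndexTwo D N p f) [NeZero D]
    (hsf : Squarefree D) (hNp : N.Coprime (p - 1)) {ζ : ℂ} {ψ : AddChar F ℂ}
    (hψ : ∀ x, ψ x = ζ ^ (Algebra.trace (ZMod p) F x).val) {χ : MulChar F ℂ} (hχ : χ ^ N = 1)
    {Q : ℕ} (hQ : gaussSum χ ψ * gaussSum χ⁻¹ ψ = Q) {τ : ℂ}
    (hτ : τ = gaussSum (jacobiChar D) ZMod.stdAddChar) (hτ2 : τ ^ 2 = -D) :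
    ∃ B C : ℤ, 2 * gaussSum χ ψ = B + C * τ ∧ 2 * gaussSum χ⁻¹ ψ = B - C * τ ∧
      B ^ 2 + D * C ^ 2 = 4 * Q := by
  have : CharP F p := (Algebra.charP_iff (ZMod p) F p).1 inferInstance
  have hN : N ≠ 0 := by have := H.one_lt; omega
  have hNp0 : N * p ≠ 0 := mul_ne_zero hN hp.out.ne_zero
  have hz := Complex.isPrimitiveRoot_exp (N * p) hNp0
  have hD : (D : ℂ) ≠ 0 := Nat.cast_ne_zero.2 (NeZero.ne D)
  have hχ' : χ⁻¹ ^ N = 1 := by rw [inv_pow, hχ, inv_one]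
  obtain ⟨P, hP⟩ := exists_aeval_eq_gaussSum hz hN hχ hNp ψ
  obtain ⟨P', hP'⟩ := exists_aeval_eq_gaussSum hz hN hχ' hNp ψ
  obtain ⟨T, hT⟩ := exists_aeval_eq_jacobiSym_mul (H.dvd.mul_right p)
    (Nat.pos_of_ne_zero hNp0) hz
  rw [← hτ] at hT
  have hP1 := hP 1 (Nat.coprime_one_left _)
  have hP1' := hP' 1 (Nat.coprime_one_left _)
  have hT1 := hT 1 (Nat.coprime_one_left _)
  simp only [pow_one, Nat.cast_one, jacobiSym.one_left, Int.cast_one, one_mul] at hP1 hP1' hT1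
  obtain ⟨B, hB⟩ := exists_int_of_aeval_pow_eq (Nat.pos_of_ne_zero hNp0) hz (P + P') fun a ha => by
    rw [map_add, map_add, hP a ha, hP' a ha, hP1, hP1']
    rcases H.gaussSum_pow hψ hχ ha.coprime_mul_right_right with ⟨-, h1, h2⟩ | ⟨-, h1, h2⟩
    · rw [h1, h2]
    · rw [h1, h2, add_comm]
  obtain ⟨R, hR⟩ := exists_int_of_aeval_pow_eq (Nat.pos_of_ne_zero hNp0) hz ((P - P') * T)
    fun a ha => by
      rw [map_mul, map_mul, map_sub, map_sub, hP a ha, hP' a ha, hT a ha, hP1, hP1', hT1]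
      rcases H.gaussSum_pow hψ hχ ha.coprime_mul_right_right with ⟨h0, h1, h2⟩ | ⟨h0, h1, h2⟩
      · rw [h0, h1, h2, Int.cast_one, one_mul]
      · rw [h0, h1, h2, Int.cast_neg, Int.cast_one]
        ring
  rw [map_add, hP1, hP1'] at hB
  rw [map_mul, map_sub, hP1, hP1', hT1] at hR
  have h1 : gaussSum χ ψ - gaussSum χ⁻¹ ψ = (-R / D) * τ := by
    field_simp
    linear_combination (-τ) * hR + (gaussSum χ ψ - gaussSum χ⁻¹ ψ) * hτ2
  have h2 : (D : ℂ) * (-R / D) ^ 2 = (4 * Q - B ^ 2 : ℤ) := by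
    push_cast
    rw [← hB, ← hQ]
    linear_combination (-R / D : ℂ) ^ 2 * hτ2 + (gaussSum χ ψ - gaussSum χ⁻¹ ψ + -R / D * τ) * h1
  have h3 : (D : ℚ) * (-R / D) ^ 2 = (4 * Q - B ^ 2 : ℤ) := by
    exact_mod_cast h2
  obtain ⟨C, hC⟩ := ImaginaryQuadratic.exists_int_of_squarefree hsf h3
  have hC' : (-R / D : ℂ) = C := by exact_mod_cast congrArg (Rat.cast (K := ℂ)) hC
  rw [hC'] at h1
  refine ⟨B, C, ?_, ?_, ?_⟩
  · linear_combination hB + h1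
  · linear_combination hB - h1
  · rw [hC] at h3
    have h4 : (D : ℤ) * C ^ 2 = 4 * Q - B ^ 2 := by exact_mod_cast h3
    linear_combination h4

end

namespace ValuationSubring

variable {K : Type*} [Field K] {A : ValuationSubring K}

theorem exists_eq_mul_pow_of_valuation_eq {p : ℕ} (hp : p.Prime) (hA : A.valuation p < 1)
    (hp0 : A.valuation p ≠ 0) {B : ℤ} {e : ℕ} (hB : A.valuation B = A.valuation p ^ e) :
    ∃ b : ℤ, ¬ (p : ℤ) ∣ b ∧ B = b * p ^ e := by
  have hB0 : B ≠ 0 := by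
    rintro rfl
    rw [Int.cast_zero, map_zero] at hB
    exact pow_ne_zero e hp0 hB.symm
  obtain ⟨b, hb, hpb⟩ := (Int.finiteMultiplicity_iff (a := (p : ℤ)) (b := B)).2
    ⟨by rw [Int.natAbs_natCast]; exact hp.ne_one, hB0⟩ |>.exists_eq_pow_mul_and_not_dvd
  have h1 := congrArg (fun z : ℤ => A.valuation (z : K)) hb
  simp only [Int.cast_mul, Int.cast_pow, Int.cast_natCast, map_mul, map_pow, hB,
    valuation_intCast_eq_one hp hA hpb, mul_one] at h1
  rw [← (pow_right_strictAnti₀ (zero_lt_iff.2 hp0) hA).injective h1] at hb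
  exact ⟨b, hpb, by rw [hb, mul_comm]⟩

theorem valuation_add_eq_pow_min {x y z : K} (hz0 : A.valuation z ≠ 0) (hz : A.valuation z < 1)
    {i j : ℕ} (hij : i ≠ j) (hx : A.valuation x = A.valuation z ^ i)
    (hy : A.valuation y = A.valuation z ^ j) :
    A.valuation (x + y) = A.valuation z ^ min i j := by
  have h := pow_right_strictAnti₀ (zero_lt_iff.2 hz0) hz
  rw [Valuation.map_add_of_distinct_val _ (by rw [hx, hy]; exact h.injective.ne hij), hx, hy]
  exact (h.antitone.map_min).symm

end ValuationSubring

theorem IndexTwo.exists_gaussSum_eq {p N D f r s : ℕ} [hp : Fact p.Prime] {F : Type*} [Field F]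
    [Fintype F] [Algebra (ZMod p) F] (H : IndexTwo D N p f) [NeZero D] (hD : D = r * s)
    (hr : r.Prime) (hs : s.Prime) (hrs : r ≠ s) {K : Type*} [Field K] [NumberField K]
    (hK : Module.finrank ℚ K = 2) {α : K} (hα : α ^ 2 = -(D : K))
    (hNp : N.Coprime (p - 1)) (hcard : Fintype.card F = p ^ f) {ζ : ℂ} (hζ : IsPrimitiveRoot ζ p)
    {ψ : AddChar F ℂ} (hψ : ∀ x, ψ x = ζ ^ (Algebra.trace (ZMod p) F x).val) (hψ1 : ψ ≠ 1)
    {χ : MulChar F ℂ} (hχ : orderOf χ = N) {τ : ℂ}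
    (hτ : τ = gaussSum (jacobiChar D) ZMod.stdAddChar) (hτ2 : τ ^ 2 = -D) :
    ∃ (h0 : ℕ) (b c : ℤ), f = 2 * h0 + NumberField.classNumber K ∧ ¬ (p : ℤ) ∣ b ∧
      ¬ (p : ℤ) ∣ c ∧ b ^ 2 + D * c ^ 2 = 4 * p ^ NumberField.classNumber K ∧
      2 * gaussSum χ ψ = (b + c * τ) * p ^ h0 ∧
      gaussSum χ ψ + gaussSum χ⁻¹ ψ = b * p ^ h0 := by
  have : CharP F p := (Algebra.charP_iff (ZMod p) F p).1 inferInstance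
  have hN := H.one_lt
  have hp0' : (p : ℂ) ≠ 0 := Nat.cast_ne_zero.2 hp.out.ne_zero
  have hsf : Squarefree D := by
    rw [hD, Nat.squarefree_mul ((Nat.coprime_primes hr hs).2 hrs)]
    exact ⟨hr.prime.squarefree, hs.prime.squarefree⟩
  have hχN : χ ^ N = 1 := by rw [← hχ, pow_orderOf_eq_one]
  have hχ1 : χ ≠ 1 := by
    rintro rfl
    rw [orderOf_one] at hχ
    omega
  have hg : gaussSum χ ψ * gaussSum χ⁻¹ ψ = (p ^ f : ℕ) := by
    rw [gaussSum_mul_gaussSum_inv_eq_card hχN hχ1 hNp (AddChar.IsPrimitive.of_ne_one hψ1), hcard]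
  obtain ⟨B, C, h1, h2, h3⟩ := H.exists_two_mul_gaussSum_eq hsf hNp hψ hχN hg hτ hτ2
  obtain ⟨A, hA⟩ := ValuationSubring.exists_valuation_natCast_lt_one ℂ hp.out
  have hp0 : A.valuation p ≠ 0 := (Valuation.ne_zero_iff _).2 hp0'
  have hF : 2 < Fintype.card F := by
    have h4 := MulChar.orderOf_dvd_card_sub_one F χ
    have h5 := Nat.le_of_dvd (Nat.sub_pos_of_lt (Fintype.one_lt_card (α := F))) h4
    have h6 := Nat.le_of_dvd (by omega) H.dvd
    have h7 := H.mod_four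
    omega
  have hz := Complex.isPrimitiveRoot_exp (Fintype.card F - 1) (by omega)
  obtain ⟨a, i, i', haN, ha, hi, hi', hvi, hvi'⟩ := ValuationSubring.exists_valuation_gaussSum hA
    hp0 hcard hF hz hζ hψ hψ1 hχ hN H.coprime hNp (by rw [hg, Nat.cast_pow, map_pow])
  have hii : i + i' = f := by
    have h4 := Nat.orbitSum_add_orbitSum_sub (f := f) hN H.coprime ha haN
    rw [hi, hi', ← mul_add, mul_comm] at h4
    exact Nat.eq_of_mul_eq_mul_right (by omega) h4
  have hh := H.abs_sub_eq_classNumber hD hr hs hrs hK hα haN ha hi hi'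
  have hpos : 0 < NumberField.classNumber K := Fintype.card_pos
  have hne : i ≠ i' := by
    rintro rfl
    rw [sub_self, abs_zero] at hh
    omega
  have hpD : ¬ (p : ℤ) ∣ (D : ℤ) := by
    rw [Int.natCast_dvd_natCast, ← hp.out.coprime_iff_not_dvd]
    exact H.coprime.coprime_dvd_right H.dvd
  have hvτ : A.valuation τ = 1 := by
    have h4 := congrArg A.valuation hτ2
    rw [map_pow, Valuation.map_neg, ← Int.cast_natCast,
      ValuationSubring.valuation_intCast_eq_one hp.out hA hpD] at h4
    exact sq_eq_one.1 h4
  have hB : gaussSum χ ψ + gaussSum χ⁻¹ ψ = B := by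
    linear_combination (h1 + h2) / 2
  have hC : gaussSum χ ψ + -gaussSum χ⁻¹ ψ = C * τ := by
    linear_combination (h1 - h2) / 2
  have hvB := ValuationSubring.valuation_add_eq_pow_min hp0 hA hne hvi hvi'
  have hvC := ValuationSubring.valuation_add_eq_pow_min hp0 hA hne hvi
    ((Valuation.map_neg _ _).trans hvi')
  rw [hB] at hvB
  rw [hC, map_mul, hvτ, mul_one] at hvC
  obtain ⟨b, hb, rfl⟩ := ValuationSubring.exists_eq_mul_pow_of_valuation_eq hp.out hA hp0 hvB
  obtain ⟨c, hc, rfl⟩ := ValuationSubring.exists_eq_mul_pow_of_valuation_eq hp.out hA hp0 hvC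
  have hf : f = 2 * min i i' + NumberField.classNumber K := by
    rcases le_total i i' with h | h <;> [rw [min_eq_left h]; rw [min_eq_right h]] <;>
    [rw [abs_of_nonpos (by omega)] at hh; rw [abs_of_nonneg (by omega)] at hh] <;> omega
  push_cast at h1 hB h3
  refine ⟨min i i', b, c, hf, hb, hc, ?_, by rw [h1]; ring, hB⟩
  have h4 : (p : ℤ) ^ (2 * min i i') ≠ 0 := pow_ne_zero _ (by exact_mod_cast hp.out.ne_zero)
  refine mul_right_cancel₀ h4 ?_
  rw [mul_assoc, ← pow_add, add_comm _ (2 * _), ← hf, ← h3]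
  ring

section

open Polynomial

theorem ValuationSubring.valuation_gaussSum_sub_lt_one {K : Type*} [Field K]
    {A : ValuationSubring K} {ℓ : ℕ} (hℓ : ℓ.Prime) (hA : A.valuation ℓ < 1) {F : Type*} [Field F]
    [Fintype F] {χ η : MulChar F K} {k : ℕ} (h : χ ^ ℓ ^ k = η ^ ℓ ^ k) (ψ : AddChar F K) :
    A.valuation (gaussSum χ ψ - gaussSum η ψ) < 1 := by
  have h1 : (χ * η⁻¹) ^ ℓ ^ k = 1 := by rw [mul_pow, inv_pow, h, mul_inv_cancel]
  rw [gaussSum, gaussSum, ← Finset.sum_sub_distrib]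
  refine valuation_sum_lt_one fun x _ => ?_
  rw [← sub_mul, map_mul, valuation_addChar_eq_one, mul_one]
  rcases eq_or_ne x 0 with rfl | hx
  · rw [MulChar.map_zero, MulChar.map_zero, sub_zero, map_zero]
    exact zero_lt_one
  · have h2 : χ x - η x = η x * ((χ * η⁻¹) x - 1) := by
      have h3 : χ x = (η * (χ * η⁻¹)) x := by rw [mul_left_comm, mul_inv_cancel, mul_one]
      rw [h3, MulChar.mul_apply η]
      ring
    rw [h2, map_mul, valuation_mulChar_eq_one η hx, one_mul]
    refine valuation_sub_one_lt_one (k := k) hℓ hA ?_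
    rw [← MulChar.pow_apply' _ (pow_ne_zero _ hℓ.ne_zero), h1, MulChar.one_apply (Ne.isUnit hx)]

variable {p : ℕ} [hp : Fact p.Prime] {F : Type*} [Field F] [Fintype F] [Algebra (ZMod p) F]
  {ζ : ℂ} {ψ : AddChar F ℂ}

theorem gaussSum_eq_pow_of_orderOf_eq_totient {r n k : ℕ} (hr : r.Prime) (hr2 : r ≠ 2)
    (hcop : p.Coprime r) (hord : orderOf (p : ZMod (r ^ n)) = (r ^ n).totient)
    (hJ : jacobiSym p r = -1) (hrp : r.Coprime (p - 1)) (hk : Odd k)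
    (hcard : Fintype.card F = p ^ (2 * (r / 2 * k)))
    (hψ : ∀ x, ψ x = ζ ^ (Algebra.trace (ZMod p) F x).val) (hψ1 : ψ ≠ 1) {η : MulChar F ℂ}
    (hη : η ^ r ^ n = 1) (hη1 : η ≠ 1) : gaussSum η ψ = p ^ (r / 2 * k) := by
  have : CharP F p := (Algebra.charP_iff (ZMod p) F p).1 inferInstance
  have : Fact r.Prime := ⟨hr⟩
  have hrn : r ^ n ≠ 0 := pow_ne_zero _ hr.ne_zero
  have h1 : ∀ {a : ℕ}, a.Coprime (r ^ n) → gaussSum (η ^ a) ψ = gaussSum η ψ := fun {a} ha => by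
    obtain ⟨j, hj⟩ := Nat.exists_modEq_pow_of_orderOf_eq_totient (Nat.pos_of_ne_zero hrn)
      (hcop.pow_right n) hord ha
    rw [pow_eq_pow_iff_modEq.2 (hj.of_dvd (orderOf_dvd_of_pow_eq_one hη)),
      gaussSum_pow_char_pow hψ]
  have h2 : gaussSum η⁻¹ ψ = gaussSum η ψ := by
    have h3 : η ^ (r ^ n - 1) = η⁻¹ := eq_inv_of_mul_eq_one_left (by
      rw [← pow_succ, Nat.sub_add_cancel (Nat.one_le_iff_ne_zero.2 hrn), hη])
    rw [← h3, h1]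
    exact (Nat.coprime_self_sub_left (Nat.one_le_iff_ne_zero.2 hrn)).2 (Nat.coprime_one_left _)
  have hz := Complex.isPrimitiveRoot_exp (r ^ n * p) (mul_ne_zero hrn hp.out.ne_zero)
  obtain ⟨P, hP⟩ := exists_aeval_eq_gaussSum hz hrn hη (hrp.pow_left n) ψ
  have hP1 := hP 1 (Nat.coprime_one_left _)
  rw [pow_one, pow_one] at hP1
  obtain ⟨G, hG⟩ := exists_int_of_aeval_pow_eq
    (Nat.pos_of_ne_zero (mul_ne_zero hrn hp.out.ne_zero)) hz P fun a ha => by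
      rw [hP a ha, h1 ha.coprime_mul_right_right, hP1]
  rw [hP1] at hG
  have h4 := gaussSum_mul_gaussSum_inv_eq_card hη hη1 (hrp.pow_left n)
    (AddChar.IsPrimitive.of_ne_one hψ1)
  rw [h2, hG, hcard] at h4
  have h5 : G ^ 2 = ((p : ℤ) ^ (r / 2 * k)) ^ 2 := by
    rw [← pow_mul, mul_comm _ 2, sq]
    exact_mod_cast h4
  have h6 : (r : ℤ) ∣ G + 1 := by
    obtain ⟨A, hA⟩ := ValuationSubring.exists_valuation_natCast_lt_one ℂ hr
    have h7 := ValuationSubring.valuation_gaussSum_sub_lt_one hr hA (χ := η) (η := 1) (k := n)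
      (by rw [hη, one_pow]) ψ
    rw [gaussSum_one_left hψ1, sub_neg_eq_add, hG] at h7
    exact (ValuationSubring.valuation_intCast_lt_one_iff hr hA).1 (by exact_mod_cast h7)
  have h7 : (r : ℤ) ∣ p ^ (r / 2 * k) + 1 := by
    rw [← ZMod.intCast_zmod_eq_zero_iff_dvd _ r]
    have h8 := legendreSym.eq_pow r p
    rw [jacobiSym.legendreSym.to_jacobiSym, hJ] at h8
    push_cast at h8 ⊢
    rw [pow_mul, ← h8, hk.neg_one_pow, neg_add_cancel]
  rcases sq_eq_sq_iff_eq_or_eq_neg.1 h5 with h | h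
  · rw [hG, h]
    push_cast
    rfl
  · rw [h] at h6
    have h8 := dvd_add h6 h7
    rw [show -(p : ℤ) ^ (r / 2 * k) + 1 + (p ^ (r / 2 * k) + 1) = (2 : ℕ) by push_cast; ring,
      Int.natCast_dvd_natCast, Nat.prime_dvd_prime_iff_eq hr Nat.prime_two] at h8
    exact absurd h8 hr2

theorem modEq_two_mul_pow_of_gaussSum_add_gaussSum_inv_eq {r ℓ m n k : ℕ} (hr : r.Prime)
    (hr2 : r ≠ 2) (hℓ : ℓ.Prime) (hn : n ≠ 0) (hrℓ : r ≠ ℓ)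
    (hcop : p.Coprime r) (hord : orderOf (p : ZMod (r ^ n)) = (r ^ n).totient)
    (hJ : jacobiSym p r = -1) (hrp : r.Coprime (p - 1)) (hk : Odd k)
    (hcard : Fintype.card F = p ^ (2 * (r / 2 * k)))
    (hψ : ∀ x, ψ x = ζ ^ (Algebra.trace (ZMod p) F x).val) (hψ1 : ψ ≠ 1) {χ : MulChar F ℂ}
    (hχ : orderOf χ = r ^ n * ℓ ^ m) {B : ℤ} (hB : gaussSum χ ψ + gaussSum χ⁻¹ ψ = B) :
    B ≡ 2 * p ^ (r / 2 * k) [ZMOD ℓ] := by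
  have hco : (r ^ n).Coprime (ℓ ^ m) := ((Nat.coprime_primes hr hℓ).2 hrℓ).pow n m
  obtain ⟨e, he1, he2⟩ := Nat.chineseRemainder hco 1 0
  have hη : (χ ^ e) ^ r ^ n = 1 := by
    rw [← pow_mul, ← orderOf_dvd_iff_pow_eq_one, hχ, mul_comm]
    exact mul_dvd_mul_right ((Nat.modEq_zero_iff_dvd).1 he2) _
  have hη1 : χ ^ e ≠ 1 := by
    intro h
    have h1 := orderOf_dvd_of_pow_eq_one h
    rw [hχ] at h1
    have h2 : r ∣ e := (dvd_pow_self r hn).trans (dvd_of_mul_right_dvd h1)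
    have h3 := (he1.of_dvd (dvd_pow_self r hn)).symm.trans (Nat.modEq_zero_iff_dvd.2 h2)
    exact hr.one_lt.ne' (Nat.dvd_one.1 (Nat.modEq_zero_iff_dvd.1 h3))
  have hχη : χ ^ ℓ ^ m = (χ ^ e) ^ ℓ ^ m := by
    rw [← pow_mul, pow_eq_pow_iff_modEq, hχ]
    simpa using (he1.symm.mul_right' (ℓ ^ m))
  have h1 := gaussSum_eq_pow_of_orderOf_eq_totient hr hr2 hcop hord hJ hrp hk hcard hψ hψ1 hη hη1
  have h2 := gaussSum_eq_pow_of_orderOf_eq_totient hr hr2 hcop hord hJ hrp hk hcard hψ hψ1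
    (η := (χ ^ e)⁻¹) (by rw [inv_pow, hη, inv_one]) (inv_ne_one.2 hη1)
  obtain ⟨A, hA⟩ := ValuationSubring.exists_valuation_natCast_lt_one ℂ hℓ
  have h3 := Valuation.map_add_lt _ (ValuationSubring.valuation_gaussSum_sub_lt_one hℓ hA hχη ψ)
    (ValuationSubring.valuation_gaussSum_sub_lt_one hℓ hA (χ := χ⁻¹) (η := (χ ^ e)⁻¹) (k := m)
      (by rw [inv_pow, inv_pow, hχη]) ψ)
  rw [h1, h2, sub_add_sub_comm, hB] at h3
  refine (Int.modEq_iff_dvd.2 ?_).symm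
  refine (ValuationSubring.valuation_intCast_lt_one_iff hℓ hA).1 ?_
  push_cast
  rwa [two_mul]

end

theorem IndexTwo.of_two_primes {r ℓ n m p f : ℕ} (hr : r.Prime) (hℓ : ℓ.Prime) (hr4 : r % 4 = 1)
    (hℓ4 : ℓ % 4 = 3) (hn : n ≠ 0) (hm : m ≠ 0) (hcop : p.Coprime (r ^ n * ℓ ^ m))
    (hJr : jacobiSym p r = -1) (hJℓ : jacobiSym p ℓ = -1)
    (hf : f = orderOf (p : ZMod (r ^ n * ℓ ^ m))) (hf2 : 2 * f = (r ^ n * ℓ ^ m).totient) :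
    IndexTwo (r * ℓ) (r ^ n * ℓ ^ m) p f where
  dvd := mul_dvd_mul (dvd_pow_self r hn) (dvd_pow_self ℓ hm)
  one_lt := Nat.one_lt_mul_iff.2 ⟨pow_pos hr.pos n, pow_pos hℓ.pos m,
    Or.inl (Nat.one_lt_pow hn hr.one_lt)⟩
  coprime_of_coprime c hc := Nat.Coprime.mul_right (hc.coprime_mul_right_right.pow_right n)
    (hc.coprime_mul_left_right.pow_right m)
  orderOf_eq := hf
  two_mul_eq := hf2
  coprime := hcop
  jacobiSym_eq_one := by
    have := Fact.mk hr
    have := Fact.mk hℓ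
    rw [jacobiSym.mul_right, hJr, hJℓ]
    rfl
  mod_four := by rw [Nat.mul_mod, hr4, hℓ4]

theorem Nat.Prime.coprime_sub_one_of_jacobiSym {r p : ℕ} (hr : r.Prime) (hp : 0 < p)
    (hJ : jacobiSym p r = -1) : r.Coprime (p - 1) := by
  rw [hr.coprime_iff_not_dvd]
  intro h
  have h1 := jacobiSym_congr dvd_rfl ((Nat.modEq_iff_dvd' hp).2 h)
  rw [hJ, Nat.cast_one, jacobiSym.one_left] at h1
  norm_num at h1

theorem Nat.totient_prime_pow_mul_prime_pow {r ℓ n m f : ℕ} (hr : r.Prime) (hℓ : ℓ.Prime)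
    (hr2 : r ≠ 2) (hℓ2 : ℓ ≠ 2) (hrℓ : r ≠ ℓ) (hn : n ≠ 0) (hm : m ≠ 0)
    (hf2 : 2 * f = (r ^ n * ℓ ^ m).totient) :
    f = 2 * (r / 2 * (r ^ (n - 1) * (ℓ ^ (m - 1) * (ℓ / 2)))) := by
  rw [Nat.totient_mul (((Nat.coprime_primes hr hℓ).2 hrℓ).pow n m),
    Nat.totient_prime_pow hr (Nat.pos_of_ne_zero hn),
    Nat.totient_prime_pow hℓ (Nat.pos_of_ne_zero hm)] at hf2
  have h1 : r - 1 = 2 * (r / 2) := by have := hr.eq_two_or_odd; omega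
  have h2 : ℓ - 1 = 2 * (ℓ / 2) := by have := hℓ.eq_two_or_odd; omega
  rw [h1, h2] at hf2
  linarith

theorem exists_gaussSum_eq_of_two_primes {r ℓ n m p f : ℕ} (hr : r.Prime) (hℓ : ℓ.Prime)
    (hr4 : r % 4 = 1) (hℓ4 : ℓ % 4 = 3) (hn : n ≠ 0) (hm : m ≠ 0) [hp : Fact p.Prime]
    (hcop : p.Coprime (r ^ n * ℓ ^ m))
    (hord1 : orderOf (p : ZMod (r ^ n)) = (r ^ n).totient)
    (hord2 : orderOf (p : ZMod (ℓ ^ m)) = (ℓ ^ m).totient)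
    (hf : f = orderOf (p : ZMod (r ^ n * ℓ ^ m))) (hf2 : 2 * f = (r ^ n * ℓ ^ m).totient)
    {F : Type*} [Field F] [Fintype F] [Algebra (ZMod p) F] (hcard : Fintype.card F = p ^ f)
    {ζ : ℂ} (hζ : IsPrimitiveRoot ζ p) {ψ : AddChar F ℂ}
    (hψ : ∀ x, ψ x = ζ ^ (Algebra.trace (ZMod p) F x).val) {χ : MulChar F ℂ}
    (hχ : orderOf χ = r ^ n * ℓ ^ m) {K : Type*} [Field K] [NumberField K]
    (hK : Module.finrank ℚ K = 2) {α : K} (hα : α ^ 2 = -((r : K) * ℓ)) {h : ℕ}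
    (hh : h = NumberField.classNumber K) :
    2 ∣ h ∧ ∃ (b c : ℤ) (τ : ℂ), ¬ (p : ℤ) ∣ b ∧ ¬ (p : ℤ) ∣ c ∧
      b ^ 2 + r * ℓ * c ^ 2 = 4 * p ^ h ∧ b ≡ 2 * p ^ (h / 2) [ZMOD ℓ] ∧
      τ ^ 2 = -(r * ℓ) ∧ gaussSum χ ψ = (b + c * τ) / 2 * p ^ ((f - h) / 2) := by
  have hr2 : r ≠ 2 := by rintro rfl; omega
  have hℓ2 : ℓ ≠ 2 := by rintro rfl; omega
  have hrℓ : r ≠ ℓ := by rintro rfl; omega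
  have hpr : p.Coprime r := hcop.coprime_dvd_right ((dvd_pow_self r hn).mul_right _)
  have hpℓ : p.Coprime ℓ := hcop.coprime_dvd_right ((dvd_pow_self ℓ hm).mul_left _)
  have hJr := jacobiSym_prime_of_orderOf_eq_totient hr hr2 hn hpr hord1
  have hJℓ := jacobiSym_prime_of_orderOf_eq_totient hℓ hℓ2 hm hpℓ hord2
  have hr1 := hr.coprime_sub_one_of_jacobiSym hp.out.pos hJr
  have hℓ1 := hℓ.coprime_sub_one_of_jacobiSym hp.out.pos hJℓ
  have H := IndexTwo.of_two_primes hr hℓ hr4 hℓ4 hn hm hcop hJr hJℓ hf hf2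
  have hf' := Nat.totient_prime_pow_mul_prime_pow hr hℓ hr2 hℓ2 hrℓ hn hm hf2
  set k := r ^ (n - 1) * (ℓ ^ (m - 1) * (ℓ / 2))
  have hk : Odd k := ((hr.odd_of_ne_two hr2).pow).mul
    (((hℓ.odd_of_ne_two hℓ2).pow).mul (Nat.odd_iff.2 (by omega)))
  have : NeZero (r * ℓ) := ⟨mul_ne_zero hr.ne_zero hℓ.ne_zero⟩
  have hψ1 : ψ ≠ 1 := by
    intro h1
    obtain ⟨x, hx⟩ := Algebra.trace_surjective (ZMod p) F 1
    have h2 := hψ x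
    have : Fact (1 < p) := ⟨hp.out.one_lt⟩
    rw [h1, AddChar.one_apply, hx, ZMod.val_one, pow_one] at h2
    exact hp.out.ne_one (hζ.unique (h2 ▸ IsPrimitiveRoot.one))
  have hτ2 := DirichletCharacter.gaussSum_sq_of_odd
    (jacobiChar_isPrimitive rfl hr hr2 hℓ hℓ2 hrℓ) (jacobiChar_odd H.mod_four)
    (jacobiChar_inv (r * ℓ))
  obtain ⟨h0, b, c, hfh, hb, hc, hbc, hg, hB⟩ := H.exists_gaussSum_eq rfl hr hℓ hrℓ hK
    (α := α) (by rw [hα, Nat.cast_mul]) ((hr1.pow_left n).mul_left (hℓ1.pow_left m)) hcard hζ hψ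
    hψ1 hχ rfl hτ2
  rw [← hh] at hfh hbc
  push_cast at hbc hτ2
  have h1 := modEq_two_mul_pow_of_gaussSum_add_gaussSum_inv_eq hr hr2 hℓ hn hrℓ hpr hord1 hJr hr1
    hk (by rw [hcard, ← hf']) hψ hψ1 hχ (B := b * p ^ h0) (by rw [hB]; push_cast; rfl)
  have h2 : 2 ∣ h := by omega
  have h3 : r / 2 * k = h / 2 + h0 := by omega
  have h4 : (f - h) / 2 = h0 := by omega
  refine ⟨h2, b, c, _, hb, hc, hbc, ?_, hτ2, ?_⟩
  · rw [h3, pow_add, ← mul_assoc, Int.modEq_iff_dvd, ← sub_mul] at h1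
    refine Int.modEq_iff_dvd.2 (IsCoprime.dvd_of_dvd_mul_right ?_ h1)
    exact (Nat.isCoprime_iff_coprime.2 hpℓ.symm).pow_right
  · rw [h4]
    linear_combination hg / 2

theorem Complex.eq_or_eq_neg_I_mul_sqrt {τ : ℂ} {x : ℝ} (hx : 0 ≤ x) (h : τ ^ 2 = -(x : ℂ)) :
    τ = I * Real.sqrt x ∨ τ = -(I * Real.sqrt x) := by
  refine sq_eq_sq_iff_eq_or_eq_neg.1 ?_
  rw [h, mul_pow, I_sq, ← ofReal_pow, Real.sq_sqrt hx, neg_one_mul]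

open scoped Classical

noncomputable section

/-- Mbodj's theorem on index-2 Gauss sums with `N = p1^m * p2^n`,
`{p1 mod 4, p2 mod 4} = {1, 3}`. -/
theorem gauss_sum_index_two_two_primes
    (p1 p2 m n N p f q : ℕ)
    (hp1 : p1.Prime) (hp2 : p2.Prime)
    (hmod : (p1 % 4 = 1 ∧ p2 % 4 = 3) ∨ (p1 % 4 = 3 ∧ p2 % 4 = 1))
    (hm : 1 ≤ m) (hn : 1 ≤ n) (hN : N = p1 ^ m * p2 ^ n)
    (hp : p.Prime) (hcop : Nat.Coprime p N)
    (hord1 : orderOf (p : ZMod (p1 ^ m)) = Nat.totient (p1 ^ m))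
    (hord2 : orderOf (p : ZMod (p2 ^ n)) = Nat.totient (p2 ^ n))
    (hf : f = orderOf (p : ZMod N)) (hf2 : 2 * f = N.totient)
    (hq : q = p ^ f)
    (F : Type) [Field F] [Fintype F] [Algebra (ZMod p) F]
    (hF : Fintype.card F = q)
    (χ : MulChar F ℂ) (hχ : orderOf χ = N)
    (K : Type) [Field K] [NumberField K]
    (hK : Module.finrank ℚ K = 2) (hKα : ∃ α : K, α ^ 2 = -((p1 : K) * (p2 : K)))
    (h h0 : ℕ) (hh : h = NumberField.classNumber K) (hh0 : h0 = (f - h) / 2)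
    (ℓ : ℕ) (hℓ : ℓ = p1 ∨ ℓ = p2) (hℓmod : ℓ % 4 = 3) :
    2 ∣ h ∧
    ∃ b c : ℤ,
      ¬ (p : ℤ) ∣ b ∧ ¬ (p : ℤ) ∣ c ∧
      b ^ 2 + (p1 : ℤ) * (p2 : ℤ) * c ^ 2 = 4 * (p : ℤ) ^ h ∧
      b ≡ 2 * (p : ℤ) ^ (h / 2) [ZMOD (ℓ : ℤ)] ∧
      ((∑ a : F, χ a * Complex.exp (2 * (Real.pi : ℂ) * Complex.I *
            ((Algebra.trace (ZMod p) F a).val : ℂ) / (p : ℂ)))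
          = (((b : ℂ) + (c : ℂ) * Complex.I * (Real.sqrt ((p1 : ℝ) * (p2 : ℝ)) : ℂ)) / 2)
              * (p : ℂ) ^ h0 ∨
       (∑ a : F, χ a * Complex.exp (2 * (Real.pi : ℂ) * Complex.I *
            ((Algebra.trace (ZMod p) F a).val : ℂ) / (p : ℂ)))
          = (((b : ℂ) - (c : ℂ) * Complex.I * (Real.sqrt ((p1 : ℝ) * (p2 : ℝ)) : ℂ)) / 2)
              * (p : ℂ) ^ h0) := by
  have := Fact.mk hp
  obtain ⟨α, hα⟩ := hKα
  subst hN hh0 hq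
  have hζ := Complex.isPrimitiveRoot_exp p hp.ne_zero
  let ψ : AddChar F ℂ :=
    ZMod.stdAddChar.compAddMonoidHom (Algebra.trace (ZMod p) F).toAddMonoidHom
  have hψ' : ∀ x, ψ x = Complex.exp (2 * Real.pi * Complex.I *
      ((Algebra.trace (ZMod p) F x).val : ℂ) / p) := fun x => by
    have h1 := ZMod.stdAddChar_coe (N := p) (Algebra.trace (ZMod p) F x).val
    rwa [Int.cast_natCast, Int.cast_natCast, ZMod.natCast_zmod_val] at h1
  have hψ : ∀ x, ψ x = Complex.exp (2 * Real.pi * Complex.I / p) ^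
      (Algebra.trace (ZMod p) F x).val := fun x => by
    rw [hψ', ← Complex.exp_nat_mul]
    ring_nf
  simp_rw [← hψ']
  change _ ∧ ∃ b c : ℤ, _ ∧ _ ∧ _ ∧ _ ∧ (gaussSum χ ψ = _ ∨ gaussSum χ ψ = _)
  suffices H : 2 ∣ h ∧ ∃ (b c : ℤ) (τ : ℂ), ¬ (p : ℤ) ∣ b ∧ ¬ (p : ℤ) ∣ c ∧
      b ^ 2 + p1 * p2 * c ^ 2 = 4 * p ^ h ∧ b ≡ 2 * p ^ (h / 2) [ZMOD ℓ] ∧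
      τ ^ 2 = -(p1 * p2) ∧ gaussSum χ ψ = (b + c * τ) / 2 * p ^ ((f - h) / 2) by
    obtain ⟨h2, b, c, τ, hb, hc, hbc, hbℓ, hτ, hg⟩ := H
    refine ⟨h2, b, c, hb, hc, hbc, hbℓ, ?_⟩
    refine (Complex.eq_or_eq_neg_I_mul_sqrt (x := p1 * p2) (by positivity)
      (by rw [hτ]; push_cast; rfl)).imp ?_ ?_ <;> rintro rfl <;> rw [hg] <;> ring
  rcases hmod with ⟨h1, h2⟩ | ⟨h1, h2⟩
  · obtain rfl : ℓ = p2 := hℓ.resolve_left (by rintro rfl; omega)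
    exact exists_gaussSum_eq_of_two_primes hp1 hp2 h1 h2 (by omega) (by omega) hcop hord1 hord2 hf
      hf2 hF hζ hψ hχ hK hα hh
  · obtain rfl : ℓ = p1 := hℓ.resolve_right (by rintro rfl; omega)
    rw [mul_comm (ℓ ^ m)] at hcop hf hf2 hχ
    rw [mul_comm (ℓ : K)] at hα
    simp_rw [mul_comm (ℓ : ℤ), mul_comm (ℓ : ℂ)]
    exact exists_gaussSum_eq_of_two_primes hp2 hp1 h2 h1 (by omega) (by omega) hcop hord2 hord1 hf
      hf2 hF hζ hψ hχ hK hα hh
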